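/- arXiv:1603.01817 — 3 statements merged into one kernel-verified Lean document; each statement's English description precedes it below -/
import Mathlib

section
/- Let E be a saturated profile associated to a fixed point E* of the coupled state evolution, with E ⪰ E* and E strictly degraded with respect to the flat MSE floor profile E_0·1 (i.e. E ≻ E_0·1). Assume the variance symmetry (1/Γ)·Σ_{r=1}^Γ J_{r,k} = 1 holds for k ∈ {2w+1,…,Γ−2w} and r_max ≤ Γ−3w. Then E_max > E_0, T_u(E_max) ≥ E_max, lim_{t→∞} T_u^{(t)}(E_max) ≥ E_max > E_0, and hence E_max does not belong to the basin of attraction V_0 of the MSE floor. -/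
open MeasureTheory ProbabilityTheory Filter Finset Real

noncomputable section

/-- Product of `B` i.i.d. standard Gaussians on `Fin B → ℝ` (law of `z`). -/
def stdGauss (B : ℕ) : Measure (Fin B → ℝ) :=
  Measure.pi fun _ => gaussianReal 0 1

/-- The `j`-th standard basis vector of `ℝ^B` (a section). -/
def basisVec (B : ℕ) (j : Fin B) : Fin B → ℝ := fun k => if k = j then 1 else 0

/-- The MMSE denoiser `f_i(Σ)` of the effective Gaussian channel. -/
def denoiser (B : ℕ) (Sn : ℝ) (s z : Fin B → ℝ) (i : Fin B) : ℝ :=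
  (1 + ∑ k ∈ Finset.univ.erase i,
      Real.exp ((s k - s i) * Real.logb 2 B / Sn ^ 2 +
        (z k - z i) * Real.sqrt (Real.logb 2 B) / Sn))⁻¹

/-- `E_{s,z}[ ∑_{i=1}^B (f_i(Σ) - s_i)^2 ]`, with `s` uniform over the basis vectors
and `z` i.i.d. standard Gaussian: the MMSE of the effective `B`-dimensional channel. -/
def mmseB (B : ℕ) (Sn : ℝ) : ℝ :=
  (B : ℝ)⁻¹ * ∑ j : Fin B,
    ∫ z, (∑ i, (denoiser B Sn (basisVec B j) z i - basisVec B j i) ^ 2) ∂ stdGauss B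

/-- Effective noise `Σ(E) = √(R(σ² + E))`. -/
def sigU (R σ2 E : ℝ) : ℝ := Real.sqrt (R * (σ2 + E))

/-- State evolution operator of the underlying system. -/
def Tu (B : ℕ) (R σ2 E : ℝ) : ℝ := mmseB B (sigU R σ2 E)

/-- Energy term of the underlying potential. -/
def Uu (R σ2 E : ℝ) : ℝ :=
  (1 / (2 * R)) * Real.logb 2 ((σ2 + E) * Real.exp (-(E / (σ2 + E))))

/-- Entropy term of the underlying potential,
`S_u(Σ) = E_z[log_B(1 + ∑_{i=2}^B e_i(Σ))]`. -/
def Su (B : ℕ) (Sn : ℝ) : ℝ :=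
  if h : 0 < B then
    letI : NeZero B := ⟨h.ne'⟩
    ∫ z, Real.logb B (1 + ∑ i ∈ Finset.univ.erase (0 : Fin B),
        Real.exp ((z i - z 0) * Real.sqrt (Real.logb 2 B) / Sn -
          Real.logb 2 B / Sn ^ 2)) ∂ stdGauss B
  else 0

/-- Potential of the underlying system. -/
def Fu (B : ℕ) (R σ2 E : ℝ) : ℝ := Uu R σ2 E - Su B (sigU R σ2 E)

/-- The MSE floor `E₀ = lim_t T_u^{(t)}(0)`. -/
def mseFloor (B : ℕ) (R σ2 : ℝ) : ℝ :=
  limUnder atTop fun t : ℕ => (Tu B R σ2)^[t] 0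

/-- Basin of attraction `𝒱₀` of the MSE floor. -/
def basin (B : ℕ) (R σ2 : ℝ) : Set ℝ :=
  {E | E ∈ Set.Icc (0:ℝ) 1 ∧
    Tendsto (fun t : ℕ => (Tu B R σ2)^[t] E) atTop (nhds (mseFloor B R σ2))}

/-- Free energy gap `ΔF_u` (`+∞` if the complement of the basin is empty). -/
def gapFu (B : ℕ) (R σ2 : ℝ) : EReal :=
  ⨅ E ∈ Set.Icc (0:ℝ) 1 \ basin B R σ2,
    ((Fu B R σ2 E - Fu B R σ2 (mseFloor B R σ2) : ℝ) : EReal)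

/-- Potential threshold `R_pot`. -/
def Rpot (B : ℕ) (σ2 : ℝ) : ℝ :=
  sSup {R : ℝ | 0 < R ∧ 0 < gapFu B R σ2}

/-- Effective noise `Σ_c(E)` of block `c` in the coupled system. -/
def sigC (R σ2 : ℝ) (Γ : ℕ) (J : Fin Γ → Fin Γ → ℝ) (E : Fin Γ → ℝ) (c : Fin Γ) : ℝ :=
  (Real.sqrt ((Γ : ℝ)⁻¹ * ∑ r, J r c / (R * (σ2 + E r))))⁻¹

/-- Coupled state evolution operator `[T_c(E)]_r`. -/
def Tc (B : ℕ) (R σ2 : ℝ) (Γ : ℕ) (J : Fin Γ → Fin Γ → ℝ) (E : Fin Γ → ℝ) (r : Fin Γ) : ℝ :=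
  (Γ : ℝ)⁻¹ * ∑ c, J r c * mmseB B (sigC R σ2 Γ J E c)

/-- Coupled potential `F_c`. -/
def Fc (B : ℕ) (R σ2 : ℝ) (Γ : ℕ) (J : Fin Γ → Fin Γ → ℝ) (E : Fin Γ → ℝ) : ℝ :=
  (∑ r, Uu R σ2 (E r)) - ∑ c, Su B (sigC R σ2 Γ J E c)

/-- Shift operator: `[S(E)]_1 = E₀`, `[S(E)]_r = E_{r-1}` (0-based indexing). -/
def shiftProf (Γ : ℕ) (E0v : ℝ) (E : Fin Γ → ℝ) (r : Fin Γ) : ℝ :=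
  if r.1 = 0 then E0v else E ⟨r.1 - 1, lt_of_le_of_lt (Nat.sub_le _ _) r.isLt⟩

/-- Partial derivative of a function of a profile with respect to coordinate `r`. -/
def pderiv (Γ : ℕ) (F : (Fin Γ → ℝ) → ℝ) (r : Fin Γ) (P : Fin Γ → ℝ) : ℝ :=
  deriv (fun x => F (Function.update P r x)) (P r)

/-- Coupled SE operator with the pinning condition enforced on
`A = {1,…,3w} ∪ {Γ-3w+1,…,Γ}` (in 0-based indexing: `r < 3w` or `r ≥ Γ-3w`). -/
def TcPin (B : ℕ) (R σ2 : ℝ) (Γ w : ℕ) (J : Fin Γ → Fin Γ → ℝ) (E : Fin Γ → ℝ) (r : Fin Γ) : ℝ :=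
  if r.1 < 3*w ∨ Γ - 3*w ≤ r.1 then 0 else Tc B R σ2 Γ J E r

/-- All-ones initial profile, pinned to `0` on the pinning set `A`. -/
def onesPin (Γ w : ℕ) : Fin Γ → ℝ :=
  fun r => if r.1 < 3*w ∨ Γ - 3*w ≤ r.1 then 0 else 1

/-- Large section size (`B → ∞`) limit of the underlying potential. -/
def phiLim (R σ2 E : ℝ) : ℝ :=
  (1/(2*R)) * Real.logb 2 ((σ2 + E) * Real.exp (-(E/(σ2+E)))) -
    max 0 (1 - 1/(2 * Real.log 2 * R * (σ2 + E)))

/-- The density of a product of densities with respect to a product of probability measures. -/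
lemma pi_withDensity_prod {ι : Type*} [Fintype ι] {X : ι → Type*} [∀ i, MeasurableSpace (X i)]
    (μ ν : ∀ i, Measure (X i)) [∀ i, IsProbabilityMeasure (μ i)] [∀ i, SigmaFinite (ν i)]
    (f : ∀ i, X i → ENNReal) (hf : ∀ i, Measurable (f i))
    (hν : ∀ i, (μ i).withDensity (f i) = ν i) :
    (Measure.pi μ).withDensity (fun x => ∏ i, f i (x i)) = Measure.pi ν := by
  symm
  refine Measure.pi_eq fun s hs => ?_
  have hind : iIndepFun (fun i (x : ∀ i, X i) => (s i).indicator (f i) (x i)) (Measure.pi μ) :=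
    iIndepFun_pi fun i => ((hf i).indicator (hs i)).aemeasurable
  have hprod := lintegral_prod_eq_prod_lintegral_of_indepFun Finset.univ _ hind
    fun i => ((hf i).indicator (hs i)).comp (measurable_pi_apply i)
  rw [withDensity_apply _ (MeasurableSet.univ_pi hs),
    ← lintegral_indicator (MeasurableSet.univ_pi hs)]
  have hcongr : (Set.univ.pi s).indicator (fun x : ∀ i, X i => ∏ i, f i (x i)) =
      fun x => ∏ i, (s i).indicator (f i) (x i) := by
    classical
    ext x
    by_cases hx : x ∈ Set.univ.pi s
    · rw [Set.indicator_of_mem hx]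
      exact Finset.prod_congr rfl fun i _ =>
        (Set.indicator_of_mem (hx i (Set.mem_univ i)) _).symm
    · rw [Set.indicator_of_notMem hx]
      simp only [Set.mem_univ_pi, not_forall] at hx
      obtain ⟨i, hi⟩ := hx
      exact (Finset.prod_eq_zero (Finset.mem_univ i) (Set.indicator_of_notMem hi _)).symm
  rw [hcongr, hprod]
  refine Finset.prod_congr rfl fun i _ => ?_
  rw [← hν i, withDensity_apply _ (hs i), ← lintegral_indicator (hs i)]
  exact (measurePreserving_eval μ i).lintegral_comp ((hf i).indicator (hs i))

/-- Exponential change of measure for a standard Gaussian on the line. -/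
lemma gaussianReal_withDensity_exp (m : ℝ) :
    (gaussianReal 0 1).withDensity (fun x => ENNReal.ofReal (Real.exp (m * x - m ^ 2 / 2))) =
      gaussianReal m 1 := by
  rw [gaussianReal_of_var_ne_zero _ one_ne_zero, gaussianReal_of_var_ne_zero _ one_ne_zero,
    ← withDensity_mul _ (measurable_gaussianPDF 0 1) (by fun_prop)]
  congr 1
  ext x
  rw [Pi.mul_apply, gaussianPDF_def, gaussianPDF_def,
    ← ENNReal.ofReal_mul (gaussianPDFReal_nonneg _ _ _), gaussianPDFReal_def, gaussianPDFReal_def]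
  dsimp only
  rw [mul_assoc, ← Real.exp_add]
  congr 3
  simp
  ring

instance isProbabilityMeasure_stdGauss (B : ℕ) : IsProbabilityMeasure (stdGauss B) := by
  unfold stdGauss; infer_instance

/-- Cameron–Martin formula: translating the standard Gaussian by `m`. -/
lemma stdGauss_map_add (B : ℕ) (m : Fin B → ℝ) :
    (stdGauss B).map (fun z => z + m) = (stdGauss B).withDensity
      (fun z => ENNReal.ofReal (Real.exp (∑ i, (m i * z i - m i ^ 2 / 2)))) := by
  have h₁ : (stdGauss B).map (fun z => z + m) = Measure.pi fun i => gaussianReal (m i) 1 := by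
    have := Measure.pi_map_pi (μ := fun _ : Fin B => gaussianReal 0 1)
      (f := fun i x => x + m i) (fun i => by fun_prop)
    simp only [gaussianReal_map_add_const, zero_add] at this
    exact this
  rw [h₁, ← pi_withDensity_prod (fun _ => gaussianReal 0 1) _ _ (fun i => by fun_prop)
    (fun i => gaussianReal_withDensity_exp (m i))]
  unfold stdGauss
  congr 1
  ext z
  rw [Real.exp_sum, ENNReal.ofReal_prod_of_nonneg fun i _ => (Real.exp_pos _).le]

/-- A combination of two independent standard Gaussians with squared weights summing to one is
standard Gaussian. -/
lemma stdGauss_prod_map (B : ℕ) {ρ τ : ℝ} (h : τ ^ 2 + ρ ^ 2 = 1) :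
    ((stdGauss B).prod (stdGauss B)).map (fun p => τ • p.1 + ρ • p.2) = stdGauss B := by
  have hline : ((gaussianReal 0 1).prod (gaussianReal 0 1)).map
      (fun p : ℝ × ℝ => τ * p.1 + ρ * p.2) = gaussianReal 0 1 := by
    have hcomp : (fun p : ℝ × ℝ => τ * p.1 + ρ * p.2) =
        (fun p : ℝ × ℝ => p.1 + p.2) ∘ Prod.map (τ * ·) (ρ * ·) := rfl
    rw [hcomp, ← Measure.map_map (by fun_prop) (by fun_prop),
      ← Measure.map_prod_map _ _ (by fun_prop) (by fun_prop),
      gaussianReal_map_const_mul, gaussianReal_map_const_mul]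
    change Measure.conv _ _ = _
    rw [gaussianReal_conv_gaussianReal]
    congr 1
    · simp
    · ext; simpa using h
  have hpi := Measure.pi_map_pi (μ := fun _ : Fin B => (gaussianReal 0 1).prod (gaussianReal 0 1))
    (f := fun _ (p : ℝ × ℝ) => τ * p.1 + ρ * p.2) (fun i => by fun_prop)
  simp only [hline] at hpi
  have harrow := (measurePreserving_arrowProdEquivProdArrow ℝ ℝ (Fin B)
    (fun _ => gaussianReal 0 1) (fun _ => gaussianReal 0 1)).map_eq
  unfold stdGauss
  rw [← harrow, Measure.map_map (by fun_prop) (MeasurableEquiv.measurable _), ← hpi]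
  rfl

/-- The posterior mean of a section as a function of the log-likelihoods. -/
def softmaxVec (B : ℕ) (u : Fin B → ℝ) (i : Fin B) : ℝ :=
  Real.exp (u i) / ∑ k, Real.exp (u k)

lemma softmaxVec_mem_Icc (B : ℕ) (u : Fin B → ℝ) (i : Fin B) :
    softmaxVec B u i ∈ Set.Icc (0 : ℝ) 1 := by
  have hle : Real.exp (u i) ≤ ∑ k, Real.exp (u k) :=
    Finset.single_le_sum (f := fun k => Real.exp (u k)) (fun k _ => (Real.exp_pos _).le)
      (Finset.mem_univ i)
  exact ⟨div_nonneg (Real.exp_pos _).le ((Real.exp_pos _).le.trans hle),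
    div_le_one_of_le₀ hle ((Real.exp_pos _).le.trans hle)⟩

lemma measurable_softmaxVec (B : ℕ) : Measurable (softmaxVec B) := by
  unfold softmaxVec; fun_prop

/-- Squared error of an estimate `v` of the section `basisVec B j`. -/
def sectionLoss (B : ℕ) (v : Fin B → ℝ) (j : Fin B) : ℝ :=
  ∑ i, (v i - basisVec B j i) ^ 2

lemma measurable_sectionLoss (B : ℕ) (j : Fin B) : Measurable (fun v => sectionLoss B v j) := by
  unfold sectionLoss; fun_prop

lemma norm_sectionLoss_le (B : ℕ) {v : Fin B → ℝ} (hv : ∀ i, v i ∈ Set.Icc (0 : ℝ) 1)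
    (j : Fin B) : ‖sectionLoss B v j‖ ≤ B := by
  rw [Real.norm_of_nonneg (by unfold sectionLoss; positivity)]
  calc sectionLoss B v j ≤ ∑ _i : Fin B, (1 : ℝ) := by
        refine Finset.sum_le_sum fun i _ => ?_
        obtain ⟨h0, h1⟩ := hv i
        unfold basisVec
        split_ifs <;> nlinarith
    _ = B := by simp

/-- The posterior mean minimizes the posterior expected loss. -/
lemma sum_exp_mul_sectionLoss_le (B : ℕ) (u v : Fin B → ℝ) :
    ∑ j, Real.exp (u j) * sectionLoss B (softmaxVec B u) j ≤
      ∑ j, Real.exp (u j) * sectionLoss B v j := by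
  unfold sectionLoss
  simp only [Finset.mul_sum]
  rw [Finset.sum_comm, Finset.sum_comm (s := Finset.univ) (t := Finset.univ)
    (f := fun j i => Real.exp (u j) * (v i - basisVec B j i) ^ 2)]
  refine Finset.sum_le_sum fun i _ => ?_
  set W := ∑ k, Real.exp (u k) with hW
  have hWpos : 0 < W := Finset.sum_pos (fun k _ => Real.exp_pos _) ⟨i, Finset.mem_univ i⟩
  have key : ∀ t : ℝ, ∑ j, Real.exp (u j) * (t - basisVec B j i) ^ 2 =
      W * t ^ 2 - 2 * t * Real.exp (u i) + Real.exp (u i) := by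
    intro t
    have hterm : ∀ j, Real.exp (u j) * (t - basisVec B j i) ^ 2 =
        Real.exp (u j) * t ^ 2 + (if i = j then Real.exp (u j) * (1 - 2 * t) else 0) := by
      intro j
      unfold basisVec
      split_ifs <;> ring
    simp only [hterm, Finset.sum_add_distrib, ← Finset.sum_mul, Finset.sum_ite_eq,
      Finset.mem_univ, if_true]
    rw [← hW]
    ring
  rw [key, key, softmaxVec, ← hW]
  have hsq : W * v i ^ 2 - 2 * v i * Real.exp (u i) + Real.exp (u i) -
      (W * (Real.exp (u i) / W) ^ 2 - 2 * (Real.exp (u i) / W) * Real.exp (u i)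
        + Real.exp (u i)) = W * (v i - Real.exp (u i) / W) ^ 2 := by
    field_simp
    ring
  nlinarith [mul_nonneg hWpos.le (sq_nonneg (v i - Real.exp (u i) / W))]

/-- Translation along a section, expressed through an exponential weight. -/
lemma integral_stdGauss_add_smul_basisVec (B : ℕ) (c : ℝ) (j : Fin B) {G : (Fin B → ℝ) → ℝ}
    (hG : Measurable G) (C : ℝ) (hC : ∀ z, ‖G z‖ ≤ C) :
    Integrable (fun z => Real.exp (c * z j - c ^ 2 / 2) * G z) (stdGauss B) ∧
    ∫ z, G (z + c • basisVec B j) ∂stdGauss B =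
      ∫ z, Real.exp (c * z j - c ^ 2 / 2) * G z ∂stdGauss B := by
  have hsum : ∀ z : Fin B → ℝ, ∑ i, ((c • basisVec B j) i * z i - (c • basisVec B j) i ^ 2 / 2) =
      c * z j - c ^ 2 / 2 := by
    intro z
    rw [Finset.sum_eq_single j]
    · simp [basisVec]
    · intro i _ hi
      simp [basisVec, hi]
    · simp
  have hmap := stdGauss_map_add B (c • basisVec B j)
  simp only [hsum] at hmap
  have hmeas : Measurable fun z : Fin B → ℝ =>
      ENNReal.ofReal (Real.exp (c * z j - c ^ 2 / 2)) := by fun_prop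
  have hshift : Measurable fun z : Fin B → ℝ => z + c • basisVec B j := by fun_prop
  have : IsProbabilityMeasure ((stdGauss B).map fun z => z + c • basisVec B j) :=
    Measure.isProbabilityMeasure_map hshift.aemeasurable
  have hint : Integrable G ((stdGauss B).map fun z => z + c • basisVec B j) :=
    Integrable.of_bound hG.aestronglyMeasurable C (ae_of_all _ hC)
  constructor
  · rw [hmap, integrable_withDensity_iff_integrable_smul₀' hmeas.aemeasurable
      (ae_of_all _ fun _ => ENNReal.ofReal_lt_top)] at hint
    simpa [ENNReal.toReal_ofReal (Real.exp_pos _).le] using hint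
  · rw [← integral_map (f := G) hshift.aemeasurable hG.aestronglyMeasurable, hmap,
      integral_withDensity_eq_integral_toReal_smul hmeas
        (ae_of_all _ fun _ => ENNReal.ofReal_lt_top)]
    simp [ENNReal.toReal_ofReal (Real.exp_pos _).le]

/-- Bayes optimality of the posterior mean among bounded estimators. -/
lemma sum_integral_sectionLoss_softmaxVec_le (B : ℕ) (c : ℝ)
    {h : (Fin B → ℝ) → Fin B → ℝ} (hm : Measurable h)
    (hh : ∀ y i, h y i ∈ Set.Icc (0 : ℝ) 1) :
    ∑ j, ∫ z, sectionLoss B (softmaxVec B (c • (z + c • basisVec B j))) j ∂stdGauss B ≤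
      ∑ j, ∫ z, sectionLoss B (h (z + c • basisVec B j)) j ∂stdGauss B := by
  have hsm : Measurable fun y : Fin B → ℝ => softmaxVec B (c • y) :=
    (measurable_softmaxVec B).comp (measurable_const_smul c)
  have hf := fun j => integral_stdGauss_add_smul_basisVec B c j
    ((measurable_sectionLoss B j).comp hsm) B
    fun z => norm_sectionLoss_le B (fun i => softmaxVec_mem_Icc B _ i) j
  have hg := fun j => integral_stdGauss_add_smul_basisVec B c j
    ((measurable_sectionLoss B j).comp hm) B fun z => norm_sectionLoss_le B (fun i => hh z i) j
  simp only [Function.comp_apply] at hf hg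
  simp only [(hf _).2, (hg _).2]
  rw [← integral_finsetSum _ fun j _ => (hf j).1, ← integral_finsetSum _ fun j _ => (hg j).1]
  refine integral_mono (integrable_finsetSum _ fun j _ => (hf j).1)
    (integrable_finsetSum _ fun j _ => (hg j).1) fun z => ?_
  have hpt := mul_le_mul_of_nonneg_right (sum_exp_mul_sectionLoss_le B (c • z) (h z))
    (Real.exp_pos (-(c ^ 2 / 2))).le
  simp only [Finset.sum_mul, Pi.smul_apply, smul_eq_mul] at hpt
  simp only [sub_eq_add_neg, Real.exp_add]
  convert hpt using 2 <;> ring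

/-- Expected total loss of the posterior mean at signal amplitude `c`; it decreases with `c`. -/
lemma sum_integral_sectionLoss_antitone (B : ℕ) {c d : ℝ} (hd : 0 ≤ d) (hc : 0 < c) (hdc : d ≤ c) :
    ∑ j, ∫ z, sectionLoss B (softmaxVec B (c • (z + c • basisVec B j))) j ∂stdGauss B ≤
      ∑ j, ∫ z, sectionLoss B (softmaxVec B (d • (z + d • basisVec B j))) j ∂stdGauss B := by
  set ρ := d / c with hρ
  have hρ0 : 0 ≤ ρ := div_nonneg hd hc.le
  have hρ1 : ρ ≤ 1 := div_le_one_of_le₀ hdc hc.le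
  have hρc : ρ * c = d := div_mul_cancel₀ d hc.ne'
  set τ := Real.sqrt (1 - ρ ^ 2) with hτ
  have hτρ : τ ^ 2 + ρ ^ 2 = 1 := by
    rw [hτ, Real.sq_sqrt (by nlinarith)]
    ring
  have hbound : ∀ j (u : Fin B → ℝ), ‖sectionLoss B (softmaxVec B u) j‖ ≤ B := fun j u =>
    norm_sectionLoss_le B (fun i => softmaxVec_mem_Icc B _ i) j
  have hmeas : ∀ j, Measurable fun u => sectionLoss B (softmaxVec B u) j := fun j =>
    (measurable_sectionLoss B j).comp (measurable_softmaxVec B)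
  set F : Fin B → (Fin B → ℝ) → (Fin B → ℝ) → ℝ := fun j x z =>
    sectionLoss B (softmaxVec B (d • (τ • x + ρ • (z + c • basisVec B j)))) j with hF
  have hFint : ∀ j, Integrable (fun p : (Fin B → ℝ) × (Fin B → ℝ) => F j p.1 p.2)
      ((stdGauss B).prod (stdGauss B)) := fun j =>
    Integrable.of_bound ((hmeas j).comp (by fun_prop)).aestronglyMeasurable B
      (ae_of_all _ fun p => hbound j _)
  have hrhs : ∀ j, ∫ z, sectionLoss B (softmaxVec B (d • (z + d • basisVec B j))) j ∂stdGauss B =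
      ∫ x, ∫ z, F j x z ∂stdGauss B ∂stdGauss B := by
    intro j
    rw [← integral_prod (fun p : (Fin B → ℝ) × (Fin B → ℝ) => F j p.1 p.2) (hFint j)]
    conv_lhs => rw [← stdGauss_prod_map B hτρ]
    have hcomp : Measurable fun z : Fin B → ℝ =>
        sectionLoss B (softmaxVec B (d • (z + d • basisVec B j))) j :=
      (hmeas j).comp (by fun_prop)
    rw [integral_map (by fun_prop) hcomp.aestronglyMeasurable]
    refine integral_congr_ae (ae_of_all _ fun p => ?_)
    simp only [hF]
    rw [smul_add ρ, smul_smul, hρc, ← add_assoc]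
  simp only [hrhs]
  rw [← integral_finsetSum _ fun j _ => (hFint j).integral_prod_left]
  calc _ = ∫ _x, ∑ j, ∫ z, sectionLoss B (softmaxVec B (c • (z + c • basisVec B j))) j
        ∂stdGauss B ∂stdGauss B := by simp
    _ ≤ _ := by
      refine integral_mono (integrable_const _)
        (integrable_finsetSum _ fun j _ => (hFint j).integral_prod_left) fun x => ?_
      exact sum_integral_sectionLoss_softmaxVec_le B c
        (h := fun y => softmaxVec B (d • (τ • x + ρ • y)))
        ((measurable_softmaxVec B).comp (by fun_prop)) fun y i => softmaxVec_mem_Icc B _ i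

lemma denoiser_eq_softmaxVec (B : ℕ) (hB : 1 ≤ B) (Sn : ℝ) (s z : Fin B → ℝ) (i : Fin B) :
    denoiser B Sn s z i = softmaxVec B ((Real.sqrt (Real.logb 2 B) / Sn) •
      (z + (Real.sqrt (Real.logb 2 B) / Sn) • s)) i := by
  have hlog : 0 ≤ Real.logb 2 B := Real.logb_nonneg one_lt_two (by exact_mod_cast hB)
  have hsq : (Real.sqrt (Real.logb 2 B) / Sn) * (Real.sqrt (Real.logb 2 B) / Sn) =
      Real.logb 2 B / Sn ^ 2 := by
    rw [div_mul_div_comm, Real.mul_self_sqrt hlog, sq]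
  rw [denoiser, softmaxVec, ← inv_div,
    ← Finset.add_sum_erase Finset.univ _ (Finset.mem_univ i), add_div,
    div_self (Real.exp_pos _).ne', Finset.sum_div]
  congr 2
  refine Finset.sum_congr rfl fun k _ => ?_
  rw [← Real.exp_sub]
  congr 1
  simp only [Pi.smul_apply, Pi.add_apply, smul_eq_mul]
  rw [mul_div_assoc, mul_div_assoc, ← hsq]
  ring

/-- The effective-channel MMSE is nondecreasing in the noise level. -/
lemma mmseB_mono (B : ℕ) (hB : 2 ≤ B) {S S' : ℝ} (hS : 0 < S) (hSS : S ≤ S') :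
    mmseB B S ≤ mmseB B S' := by
  have hlog : 0 < Real.logb 2 B :=
    Real.logb_pos one_lt_two (by exact_mod_cast (by omega : 1 < B))
  simp only [mmseB, denoiser_eq_softmaxVec B (by omega)]
  refine mul_le_mul_of_nonneg_left ?_ (by positivity)
  exact sum_integral_sectionLoss_antitone B (div_nonneg (Real.sqrt_nonneg _) (hS.trans_le hSS).le)
    (div_pos (Real.sqrt_pos.2 hlog) hS)
    (div_le_div_of_nonneg_left (Real.sqrt_nonneg _) hS hSS)

lemma Tu_mono (B : ℕ) (hB : 2 ≤ B) {R σ2 x y : ℝ} (hR : 0 < R) (hσ2 : 0 < σ2) (hx : 0 ≤ x)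
    (hxy : x ≤ y) : Tu B R σ2 x ≤ Tu B R σ2 y :=
  mmseB_mono B hB (Real.sqrt_pos.2 (by positivity))
    (Real.sqrt_le_sqrt (mul_le_mul_of_nonneg_left (by linarith) hR.le))

lemma le_iterate_Tu (B : ℕ) (hB : 2 ≤ B) {R σ2 x : ℝ} (hR : 0 < R) (hσ2 : 0 < σ2) (hx : 0 ≤ x)
    (hxT : x ≤ Tu B R σ2 x) (t : ℕ) : x ≤ (Tu B R σ2)^[t] x := by
  induction t with
  | zero => exact le_rfl
  | succ t ih =>
    rw [Function.iterate_succ_apply']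
    exact hxT.trans (Tu_mono B hB hR hσ2 hx ih)

/-- A coupled block whose incoming variances average to one sees at most the effective noise of
the flat profile dominating `P`. -/
lemma mmseB_sigC_le_Tu (B : ℕ) (hB : 2 ≤ B) {R σ2 : ℝ} (hR : 0 < R) (hσ2 : 0 < σ2) {Γ : ℕ}
    {J : Fin Γ → Fin Γ → ℝ} (hJ : ∀ r c, 0 ≤ J r c) {P : Fin Γ → ℝ} (hP : ∀ r, 0 ≤ P r) {M : ℝ}
    (hPM : ∀ r, P r ≤ M) (c : Fin Γ) (hcol : (Γ : ℝ)⁻¹ * ∑ r, J r c = 1) :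
    mmseB B (sigC R σ2 Γ J P c) ≤ Tu B R σ2 M := by
  have hM : 0 ≤ M := (hP c).trans (hPM c)
  have hRM : 0 < R * (σ2 + M) := by positivity
  have hle : (R * (σ2 + M))⁻¹ ≤ (Γ : ℝ)⁻¹ * ∑ r, J r c / (R * (σ2 + P r)) := by
    calc (R * (σ2 + M))⁻¹ = (Γ : ℝ)⁻¹ * ∑ r, J r c / (R * (σ2 + M)) := by
          rw [← Finset.sum_div, ← mul_div_assoc, hcol, one_div]
      _ ≤ _ := by
          refine mul_le_mul_of_nonneg_left (Finset.sum_le_sum fun r _ => ?_) (by positivity)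
          have := hP r
          exact div_le_div_of_nonneg_left (hJ r c) (by positivity)
            (mul_le_mul_of_nonneg_left (by linarith [hPM r]) hR.le)
  have hpos := (inv_pos.2 hRM).trans_le hle
  refine mmseB_mono B hB (inv_pos.2 (Real.sqrt_pos.2 hpos)) ?_
  rw [sigC, sigU, ← Real.sqrt_inv]
  exact Real.sqrt_le_sqrt (inv_le_of_inv_le₀ hRM hle)

/-- for a saturated profile strictly degraded w.r.t. the flat MSE
floor profile, `E_max` lies outside the basin of attraction `𝒱₀` of the floor. -/
theorem Emax_outside_basin
    (B : ℕ) (hB : 2 ≤ B) (R σ2 : ℝ) (hR : 0 < R) (hσ2 : 0 < σ2)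
    (Γ w : ℕ) (hw : 0 < w) (hΓ : 8 * w < Γ)
    (g : ℝ → ℝ) (g0 gs : ℝ) (hg0 : 0 < g0) (hgs : 0 ≤ gs)
    (hsupp : ∀ x : ℝ, 1 < |x| → g x = 0)
    (hlow : ∀ x : ℝ, |x| ≤ 1 → g0 ≤ g x)
    (hlip : ∀ x ∈ Set.Icc (-1:ℝ) 1, ∀ y ∈ Set.Icc (-1:ℝ) 1, |g x - g y| ≤ gs * |x - y|)
    (hgnorm : (2*(w:ℝ)+1)⁻¹ * ∑ k ∈ Finset.Icc (-(w:ℤ)) (w:ℤ), g ((k:ℝ)/(w:ℝ)) = 1)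
    (γv : Fin Γ → ℝ) (hγ : ∀ r, 0 < γv r)
    (J : Fin Γ → Fin Γ → ℝ)
    (hJ : ∀ r c : Fin Γ, J r c = γv r * (Γ:ℝ) * g (((r.1:ℝ) - (c.1:ℝ))/(w:ℝ)) / (2*(w:ℝ)+1))
    (hrow : ∀ r : Fin Γ, (Γ:ℝ)⁻¹ * ∑ c, J r c = 1)
    (hsym : ∀ k : Fin Γ, 2*w ≤ k.1 → k.1 < Γ - 2*w → (Γ:ℝ)⁻¹ * ∑ r, J r k = 1)
    (Estar : Fin Γ → ℝ)
    (hstarbox : ∀ r, Estar r ∈ Set.Icc (0:ℝ) 1)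
    (hpin : ∀ r : Fin Γ, (r.1 < 3*w ∨ Γ - 3*w ≤ r.1) → Estar r = 0)
    (hfixstar : ∀ r : Fin Γ, ¬(r.1 < 3*w ∨ Γ - 3*w ≤ r.1) → Tc B R σ2 Γ J Estar r = Estar r)
    (E : Fin Γ → ℝ) (rstar rmax : Fin Γ) (Emax : ℝ)
    (hbox : ∀ r, E r ∈ Set.Icc (0:ℝ) 1)
    (hmono : ∀ r r' : Fin Γ, r ≤ r' → E r ≤ E r')
    (hrsm : rstar ≤ rmax)
    (hrmaxloc : rmax.1 + 1 ≤ Γ - 3*w)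
    (hplat0 : ∀ r, r ≤ rstar → E r = mseFloor B R σ2)
    (hplatmax : ∀ r, rmax ≤ r → E r = Emax)
    (hmid : ∀ r : Fin Γ, rstar ≤ r → r ≤ rmax → E r = Estar r)
    (hEmaxatt : Estar rmax = Emax)
    (hEmaxub : ∀ r, Estar r ≤ Emax)
    (hdeg : ∀ r, Estar r ≤ E r)
    (hstrict : (∀ r, mseFloor B R σ2 ≤ E r) ∧ ∃ r, mseFloor B R σ2 < E r) :
    mseFloor B R σ2 < Emax ∧
    Emax ≤ Tu B R σ2 Emax ∧
    (∀ L : ℝ, Tendsto (fun t : ℕ => (Tu B R σ2)^[t] Emax) atTop (nhds L) → Emax ≤ L) ∧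
    Emax ∉ basin B R σ2 := by
  have hJpos : ∀ r c, 0 ≤ J r c := by
    intro r c
    rw [hJ]
    have hg : 0 ≤ g (((r.1:ℝ) - (c.1:ℝ))/(w:ℝ)) := by
      rcases le_or_gt |((r.1:ℝ) - (c.1:ℝ))/(w:ℝ)| 1 with h | h
      · exact hg0.le.trans (hlow _ h)
      · exact (hsupp _ h).ge
    have := hγ r
    positivity
  have hfloor : mseFloor B R σ2 < Emax := by
    obtain ⟨r, hr⟩ := hstrict.2
    have h := hmono r (max r rmax) (le_max_left _ _)
    rw [hplatmax _ (le_max_right _ _)] at h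
    exact hr.trans_le h
  have hfloor0 : 0 ≤ mseFloor B R σ2 := hplat0 rstar le_rfl ▸ (hbox rstar).1
  have hEmax0 : 0 ≤ Emax := hfloor0.trans hfloor.le
  have hunpinned : ¬(rmax.1 < 3*w ∨ Γ - 3*w ≤ rmax.1) := fun h => by
    have := hpin rmax h
    linarith
  have hTu : Emax ≤ Tu B R σ2 Emax := by
    have hfix := hfixstar rmax hunpinned
    rw [hEmaxatt] at hfix
    calc Emax = (Γ:ℝ)⁻¹ * ∑ c, J rmax c * mmseB B (sigC R σ2 Γ J Estar c) := hfix.symm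
      _ ≤ (Γ:ℝ)⁻¹ * ∑ c, J rmax c * Tu B R σ2 Emax := by
          refine mul_le_mul_of_nonneg_left (Finset.sum_le_sum fun c _ => ?_) (by positivity)
          by_cases hc : rmax.1 ≤ c.1 + w ∧ c.1 ≤ rmax.1 + w
          · exact mul_le_mul_of_nonneg_left (mmseB_sigC_le_Tu B hB hR hσ2 hJpos
              (fun r => (hstarbox r).1) hEmaxub c (hsym c (by omega) (by omega))) (hJpos _ _)
          · have hw' : (0:ℝ) < w := by exact_mod_cast hw
            have hfar : 1 < |((rmax.1:ℝ) - (c.1:ℝ))/(w:ℝ)| := by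
              rw [abs_div, abs_of_pos hw', one_lt_div hw', lt_abs]
              rcases not_and_or.1 hc with h | h
              · left
                have : (c.1:ℝ) + w < rmax.1 := by exact_mod_cast not_le.1 h
                linarith
              · right
                have : (rmax.1:ℝ) + w < c.1 := by exact_mod_cast not_le.1 h
                linarith
            have hJ0 : J rmax c = 0 := by rw [hJ, hsupp _ hfar]; simp
            simp [hJ0]
      _ = Tu B R σ2 Emax := by rw [← Finset.sum_mul, ← mul_assoc, hrow, one_mul]
  have hlim : ∀ L : ℝ, Tendsto (fun t : ℕ => (Tu B R σ2)^[t] Emax) atTop (nhds L) → Emax ≤ L :=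
    fun L hL => ge_of_tendsto' hL (le_iterate_Tu B hB hR hσ2 hEmax0 hTu)
  exact ⟨hfloor, hTu, hlim, fun h => (hlim _ h.2).not_gt hfloor⟩
end
end

section
/- Let E be a saturated profile associated to a fixed point of the coupled state evolution, with E strictly degraded with respect to the flat MSE floor profile E_0·1 (E ≻ E_0·1), and assume the variance symmetry (1/Γ)·Σ_{r=1}^Γ J_{r,k} = 1 for k ∈ {2w+1,…,Γ−2w}. Then the change in the coupled potential under the shift satisfies F_c(S(E)) − F_c(E) = −F_u(E_max) + F_u(E_0) ≤ −ΔF_u. -/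
open MeasureTheory ProbabilityTheory Filter Finset Real

noncomputable section

instance (B : ℕ) : IsProbabilityMeasure (stdGauss B) := by
  unfold stdGauss; infer_instance

lemma gaussianReal_one_eq_withDensity (m : ℝ) :
    gaussianReal m 1 = (gaussianReal 0 1).withDensity
      (fun y => ENNReal.ofReal (Real.exp (m * y - m ^ 2 / 2))) := by
  rw [gaussianReal_of_var_ne_zero _ one_ne_zero, gaussianReal_of_var_ne_zero _ one_ne_zero,
    ← withDensity_mul _ (by fun_prop) (by fun_prop)]
  congr 1
  ext y
  simp only [gaussianPDF, gaussianPDFReal, Pi.mul_apply]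
  rw [← ENNReal.ofReal_mul (by positivity), mul_assoc (Real.sqrt _)⁻¹, ← Real.exp_add]
  congr 3
  push_cast
  ring

/-- Cameron–Martin formula for a product of standard Gaussians. -/
lemma map_add_stdGauss {B : ℕ} (m : Fin B → ℝ) :
    (stdGauss B).map (fun z i => m i + z i) = (stdGauss B).withDensity
      (fun y => ∏ i, ENNReal.ofReal (Real.exp (m i * y i - m i ^ 2 / 2))) := by
  have hmap : (stdGauss B).map (fun z i => m i + z i)
      = Measure.pi (fun i => gaussianReal (m i) 1) := by
    have h := Measure.pi_map_pi (μ := fun _ : Fin B => gaussianReal 0 1)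
      (f := fun i y => m i + y) (fun i => by fun_prop)
    simpa [stdGauss, gaussianReal_map_const_add] using h
  rw [hmap]
  refine Measure.pi_eq fun s hs => ?_
  rw [withDensity_apply _ (MeasurableSet.univ_pi hs),
    ← lintegral_indicator (MeasurableSet.univ_pi hs)]
  have hf : ∀ i : Fin B, Measurable ((s i).indicator
      (fun y : ℝ => ENNReal.ofReal (Real.exp (m i * y - m i ^ 2 / 2)))) := fun i =>
    Measurable.indicator (by fun_prop) (hs i)
  have hind := iIndepFun_pi (μ := fun _ : Fin B => gaussianReal 0 1)
    (X := fun i => (s i).indicator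
      (fun y : ℝ => ENNReal.ofReal (Real.exp (m i * y - m i ^ 2 / 2))))
    (fun i => (hf i).aemeasurable)
  have hprod := lintegral_prod_eq_prod_lintegral_of_indepFun Finset.univ _ hind
    (fun i => (hf i).comp (measurable_pi_apply i))
  have heq : (Set.univ.pi s).indicator
      (fun y => ∏ i, ENNReal.ofReal (Real.exp (m i * y i - m i ^ 2 / 2)))
      = fun y => ∏ i, (s i).indicator
        (fun y : ℝ => ENNReal.ofReal (Real.exp (m i * y - m i ^ 2 / 2))) (y i) := by
    ext y
    by_cases hy : y ∈ Set.univ.pi s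
    · rw [Set.indicator_of_mem hy]
      exact Finset.prod_congr rfl fun i _ => (Set.indicator_of_mem (hy i trivial)
        (fun y : ℝ => ENNReal.ofReal (Real.exp (m i * y - m i ^ 2 / 2)))).symm
    · rw [Set.indicator_of_notMem hy]
      obtain ⟨i, hi⟩ : ∃ i, y i ∉ s i := by simpa [Set.mem_pi] using hy
      exact (Finset.prod_eq_zero (Finset.mem_univ i) (Set.indicator_of_notMem hi _)).symm
  rw [heq, stdGauss, hprod]
  refine Finset.prod_congr rfl fun i _ => ?_
  rw [gaussianReal_one_eq_withDensity (m i), withDensity_apply _ (hs i),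
    ← lintegral_indicator (hs i)]
  exact (measurePreserving_eval (fun _ : Fin B => gaussianReal 0 1) i).lintegral_comp (hf i)

lemma prod_ofReal_exp_basisVec {B : ℕ} (x : ℝ) (j : Fin B) (y : Fin B → ℝ) :
    ∏ i, ENNReal.ofReal (Real.exp (x * basisVec B j i * y i - (x * basisVec B j i) ^ 2 / 2))
      = ENNReal.ofReal (Real.exp (x * y j - x ^ 2 / 2)) := by
  rw [Finset.prod_eq_single j]
  · simp [basisVec]
  · intro i _ hi
    simp [basisVec, hi]
  · simp

lemma integral_stdGauss_shift {B : ℕ} (x : ℝ) (j : Fin B) {h : (Fin B → ℝ) → ℝ}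
    (hh : Measurable h) :
    ∫ z, h (fun i => x * basisVec B j i + z i) ∂stdGauss B
      = ∫ y, Real.exp (x * y j - x ^ 2 / 2) * h y ∂stdGauss B := by
  have h1 := map_add_stdGauss (fun i => x * basisVec B j i)
  simp only [prod_ofReal_exp_basisVec] at h1
  rw [← integral_map (f := h) (φ := fun (z : Fin B → ℝ) i => x * basisVec B j i + z i)
      (by fun_prop : Measurable _).aemeasurable hh.aestronglyMeasurable, h1,
    integral_withDensity_eq_integral_toReal_smul (by fun_prop) (by simp)]
  simp [ENNReal.toReal_ofReal (Real.exp_pos _).le]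

lemma integrable_exp_mul_stdGauss {B : ℕ} (x : ℝ) (j : Fin B) {h : (Fin B → ℝ) → ℝ}
    (hh : Measurable h) {C : ℝ} (hC : ∀ y, |h y| ≤ C) :
    Integrable (fun y => Real.exp (x * y j - x ^ 2 / 2) * h y) (stdGauss B) := by
  have h0 : Integrable (fun y : Fin B → ℝ => Real.exp (x * y j)) (stdGauss B) :=
    (measurePreserving_eval (fun _ : Fin B => gaussianReal 0 1) j).integrable_comp_of_integrable
      (integrable_exp_mul_gaussianReal x)
  refine Integrable.mul_bdd (c := C) ?_ hh.aestronglyMeasurable (ae_of_all _ hC)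
  simpa [Real.exp_sub] using h0.div_const (Real.exp (x ^ 2 / 2))

/-- The posterior mean minimises the posterior-weighted squared error. -/
lemma sum_weighted_sq_error_le {ι : Type*} [Fintype ι] [DecidableEq ι] (v p q : ι → ℝ)
    (hv : ∀ i, 0 ≤ v i) (hp : ∀ i, p i * ∑ k, v k = v i) :
    ∑ j, v j * ∑ i, (p i - if i = j then 1 else 0) ^ 2
      ≤ ∑ j, v j * ∑ i, (q i - if i = j then 1 else 0) ^ 2 := by
  have key : ∀ f : ι → ℝ, ∑ j, v j * ∑ i, (f i - if i = j then 1 else 0) ^ 2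
      = ∑ i, ((∑ k, v k) * f i ^ 2 - 2 * v i * f i + v i) := by
    intro f
    simp_rw [Finset.mul_sum]
    rw [Finset.sum_comm]
    refine Finset.sum_congr rfl fun i _ => ?_
    have : ∀ j, v j * (f i - if i = j then 1 else 0) ^ 2
        = v j * f i ^ 2 + if i = j then v j * (1 - 2 * f i) else 0 := by
      intro j; split_ifs <;> ring
    simp_rw [this]
    rw [Finset.sum_add_distrib, Finset.sum_ite_eq, if_pos (Finset.mem_univ _), Finset.sum_mul]
    ring
  rw [key, key]
  refine Finset.sum_le_sum fun i _ => ?_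
  have hW : 0 ≤ ∑ k, v k := Finset.sum_nonneg fun k _ => hv k
  rw [← hp i]
  nlinarith [mul_nonneg hW (sq_nonneg (q i - p i))]

/-- Posterior mean of a section observed as `y = x s + z`. -/
def postMean (B : ℕ) (x : ℝ) (y : Fin B → ℝ) (i : Fin B) : ℝ :=
  Real.exp (x * y i) / ∑ k, Real.exp (x * y k)

lemma measurable_postMean {B : ℕ} (x : ℝ) (i : Fin B) :
    Measurable fun y => postMean B x y i := by
  unfold postMean; fun_prop

lemma sum_exp_pos {B : ℕ} (i : Fin B) (p : Fin B → ℝ) : 0 < ∑ k, Real.exp (p k) :=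
  Finset.sum_pos (fun _ _ => Real.exp_pos _) ⟨i, Finset.mem_univ i⟩

lemma postMean_mem {B : ℕ} (x : ℝ) (y : Fin B → ℝ) (i : Fin B) :
    postMean B x y i ∈ Set.Icc (0 : ℝ) 1 := by
  have := sum_exp_pos i fun k => x * y k
  refine ⟨by unfold postMean; positivity, ?_⟩
  exact div_le_one_of_le₀ (Finset.single_le_sum (f := fun k => Real.exp (x * y k))
    (fun _ _ => (Real.exp_pos _).le) (Finset.mem_univ i)) this.le

lemma denoiser_eq_postMean {B : ℕ} (hB : 2 ≤ B) (Sn : ℝ) (s z : Fin B → ℝ) (i : Fin B) :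
    denoiser B Sn s z i = postMean B (Real.sqrt (Real.logb 2 B) / Sn)
      (fun k => Real.sqrt (Real.logb 2 B) / Sn * s k + z k) i := by
  have hL : 0 ≤ Real.logb 2 B := Real.logb_nonneg (by norm_num) (by exact_mod_cast by omega)
  set x := Real.sqrt (Real.logb 2 B) / Sn with hx
  have hx2 : Real.logb 2 B / Sn ^ 2 = x ^ 2 := by rw [hx, div_pow, Real.sq_sqrt hL]
  have hterm : ∀ k, Real.exp ((s k - s i) * Real.logb 2 B / Sn ^ 2 +
      (z k - z i) * Real.sqrt (Real.logb 2 B) / Sn)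
      = Real.exp (x * (x * s k + z k)) / Real.exp (x * (x * s i + z i)) := by
    intro k
    rw [← Real.exp_sub, mul_div_assoc, mul_div_assoc, hx2, ← hx]
    congr 1; ring
  unfold denoiser postMean
  simp_rw [hterm]
  rw [← Finset.sum_div, ← Finset.add_sum_erase _ _ (Finset.mem_univ i)]
  field_simp

/-- Squared error of the estimate `f` of the section `basisVec B j`. -/
def sqErr (B : ℕ) (j : Fin B) (f : Fin B → ℝ) : ℝ := ∑ i, (f i - basisVec B j i) ^ 2

lemma mmseB_eq {B : ℕ} (hB : 2 ≤ B) (Sn : ℝ) :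
    mmseB B Sn = (B : ℝ)⁻¹ * ∑ j : Fin B, ∫ z, sqErr B j
      (postMean B (Real.sqrt (Real.logb 2 B) / Sn)
        (fun k => Real.sqrt (Real.logb 2 B) / Sn * basisVec B j k + z k)) ∂stdGauss B := by
  simp only [mmseB, denoiser_eq_postMean hB, sqErr]

lemma abs_sqErr_le {B : ℕ} (j : Fin B) {f : Fin B → ℝ} (hf : ∀ i, f i ∈ Set.Icc (0 : ℝ) 1) :
    |sqErr B j f| ≤ B := by
  rw [abs_of_nonneg (Finset.sum_nonneg fun i _ => sq_nonneg _)]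
  calc sqErr B j f ≤ ∑ _i : Fin B, (1 : ℝ) := by
        refine Finset.sum_le_sum fun i _ => ?_
        obtain ⟨h0, h1⟩ := hf i
        unfold basisVec
        split_ifs <;> nlinarith
    _ = B := by simp

lemma measurable_sqErr {α : Type*} [MeasurableSpace α] {B : ℕ} (j : Fin B)
    {f : α → Fin B → ℝ} (hf : ∀ i, Measurable fun a => f a i) :
    Measurable fun a => sqErr B j (f a) := by
  unfold sqErr
  exact Finset.measurable_sum _ fun i _ => ((hf i).sub_const _).pow_const _

/-- Bayes optimality of the posterior mean among bounded estimators. -/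
lemma sum_integral_sqErr_postMean_le {B : ℕ} (x : ℝ) (ψ : (Fin B → ℝ) → Fin B → ℝ)
    (hψ : ∀ i, Measurable fun y => ψ y i) (hψb : ∀ y i, ψ y i ∈ Set.Icc (0 : ℝ) 1) :
    ∑ j, ∫ z, sqErr B j (postMean B x (fun k => x * basisVec B j k + z k)) ∂stdGauss B
      ≤ ∑ j, ∫ z, sqErr B j (ψ (fun k => x * basisVec B j k + z k)) ∂stdGauss B := by
  have hm : ∀ j : Fin B, Measurable fun y => sqErr B j (postMean B x y) := fun j =>
    measurable_sqErr j (measurable_postMean x)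
  have hm' : ∀ j : Fin B, Measurable fun y => sqErr B j (ψ y) := fun j => measurable_sqErr j hψ
  have hi := fun j : Fin B => integrable_exp_mul_stdGauss x j (hm j)
    fun y => abs_sqErr_le j (postMean_mem x y)
  have hi' := fun j : Fin B => integrable_exp_mul_stdGauss x j (hm' j)
    fun y => abs_sqErr_le j (hψb y)
  simp_rw [fun j => integral_stdGauss_shift x j (hm j),
    fun j => integral_stdGauss_shift x j (hm' j)]
  rw [← integral_finsetSum _ fun j _ => hi j, ← integral_finsetSum _ fun j _ => hi' j]
  refine integral_mono (integrable_finsetSum _ fun j _ => hi j)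
    (integrable_finsetSum _ fun j _ => hi' j) fun y => ?_
  refine sum_weighted_sq_error_le (fun j => Real.exp (x * y j - x ^ 2 / 2)) (postMean B x y) (ψ y)
    (fun i => (Real.exp_pos _).le) fun i => ?_
  have := sum_exp_pos i fun k => x * y k
  simp_rw [Real.exp_sub, ← Finset.sum_div, postMean]
  field_simp

lemma measurePreserving_rotation_gaussianReal {c s : ℝ} (hcs : c ^ 2 + s ^ 2 = 1) :
    MeasurePreserving (fun p : ℝ × ℝ => c * p.1 + s * p.2)
      ((gaussianReal 0 1).prod (gaussianReal 0 1)) (gaussianReal 0 1) := by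
  refine ⟨by fun_prop, ?_⟩
  have h := gaussianReal_conv_gaussianReal (m₁ := c * 0) (m₂ := s * 0)
    (v₁ := .mk (c ^ 2) (sq_nonneg c) * 1) (v₂ := .mk (s ^ 2) (sq_nonneg s) * 1)
  rw [← gaussianReal_map_const_mul, ← gaussianReal_map_const_mul, Measure.conv,
    Measure.map_prod_map _ _ (by fun_prop) (by fun_prop),
    Measure.map_map (by fun_prop) (by fun_prop)] at h
  refine h.trans ?_
  congr 1
  · simp
  · ext; simpa using hcs

lemma measurePreserving_rotation_stdGauss {B : ℕ} {c s : ℝ} (hcs : c ^ 2 + s ^ 2 = 1) :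
    MeasurePreserving (fun p : (Fin B → ℝ) × (Fin B → ℝ) => fun k => c * p.1 k + s * p.2 k)
      ((stdGauss B).prod (stdGauss B)) (stdGauss B) := by
  have h1 := (measurePreserving_arrowProdEquivProdArrow ℝ ℝ (Fin B)
    (fun _ => gaussianReal 0 1) (fun _ => gaussianReal 0 1)).symm
  have h2 := measurePreserving_pi (fun _ : Fin B => (gaussianReal 0 1).prod (gaussianReal 0 1))
    (fun _ => gaussianReal 0 1) fun _ => measurePreserving_rotation_gaussianReal hcs
  exact h2.comp h1

/-- The minimum mean square error is nondecreasing in the noise level. -/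
lemma mmseB_mono_s10 {B : ℕ} (hB : 2 ≤ B) {a b : ℝ} (ha : 0 < a) (hab : a ≤ b) :
    mmseB B a ≤ mmseB B b := by
  have hL : 0 < Real.logb 2 B := Real.logb_pos (by norm_num) (by exact_mod_cast by omega)
  rw [mmseB_eq hB, mmseB_eq hB]
  have hb : 0 < b := ha.trans_le hab
  set x := Real.sqrt (Real.logb 2 B) / a with hx
  set x' := Real.sqrt (Real.logb 2 B) / b with hx'
  set c := a / b with hc
  have hcx : c * x = x' := by rw [hc, hx, hx']; field_simp
  have hc0 : 0 ≤ c := by positivity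
  have hc1 : c ≤ 1 := div_le_one_of_le₀ hab hb.le
  set s := Real.sqrt (1 - c ^ 2) with hs
  have hcs : c ^ 2 + s ^ 2 = 1 := by
    rw [hs, Real.sq_sqrt (by nlinarith)]; ring
  refine mul_le_mul_of_nonneg_left ?_ (by positivity)
  have hmeas : ∀ j : Fin B, Measurable fun z : Fin B → ℝ => sqErr B j
      (postMean B x' (fun k => x' * basisVec B j k + z k)) := fun j =>
    measurable_sqErr j fun i => (measurable_postMean x' i).comp
      (by fun_prop : Measurable fun (z : Fin B → ℝ) k => x' * basisVec B j k + z k)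
  have hint : ∀ j : Fin B, Integrable (fun p : (Fin B → ℝ) × (Fin B → ℝ) => sqErr B j
      (postMean B x' (fun k => x' * basisVec B j k + (c * p.1 k + s * p.2 k))))
      ((stdGauss B).prod (stdGauss B)) := fun j =>
    Integrable.of_bound ((hmeas j).comp
      (measurePreserving_rotation_stdGauss hcs).measurable).aestronglyMeasurable B
      (ae_of_all _ fun p => abs_sqErr_le j (postMean_mem _ _))
  have hrot : ∀ j : Fin B, ∫ z, sqErr B j
      (postMean B x' (fun k => x' * basisVec B j k + z k)) ∂stdGauss B
      = ∫ z', ∫ z, sqErr B j (postMean B x'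
        (fun k => x' * basisVec B j k + (c * z k + s * z' k))) ∂stdGauss B ∂stdGauss B := by
    intro j
    rw [← integral_prod_symm _ (hint j)]
    have hrp := measurePreserving_rotation_stdGauss (B := B) hcs
    rw [← hrp.map_eq, integral_map hrp.measurable.aemeasurable
      (hmeas j).aestronglyMeasurable, hrp.map_eq]
  rw [Finset.sum_congr rfl fun j _ => hrot j,
    ← integral_finsetSum _ fun j _ => (hint j).integral_prod_right]
  calc _ = ∫ _z' : Fin B → ℝ, ∑ j : Fin B, ∫ z, sqErr B j
        (postMean B x (fun k => x * basisVec B j k + z k)) ∂stdGauss B ∂stdGauss B := by simp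
    _ ≤ _ := by
      refine integral_mono (integrable_const _)
        (integrable_finsetSum _ fun j _ => (hint j).integral_prod_right) fun z' => ?_
      refine (sum_integral_sqErr_postMean_le x
        (fun y => postMean B x' (fun k => c * y k + s * z' k))
        (fun i => (measurable_postMean x' i).comp
          (by fun_prop : Measurable fun (y : Fin B → ℝ) k => c * y k + s * z' k))
        fun y i => postMean_mem _ _ i).trans_eq ?_
      refine Finset.sum_congr rfl fun j _ => ?_
      congr 1; ext z; congr 2; ext k
      rw [← hcx]; ring

section Coupling

variable {Γ : ℕ} {R σ2 : ℝ} {J : Fin Γ → Fin Γ → ℝ}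

lemma sigC_congr {P Q : Fin Γ → ℝ} {c : Fin Γ} (h : ∀ r, J r c ≠ 0 → P r = Q r) :
    sigC R σ2 Γ J P c = sigC R σ2 Γ J Q c := by
  unfold sigC
  congr 3
  refine Finset.sum_congr rfl fun r _ => ?_
  by_cases hr : J r c = 0
  · simp [hr]
  · rw [h r hr]

lemma sigC_of_eq_const {P : Fin Γ → ℝ} {c : Fin Γ} {v : ℝ}
    (hcol : (Γ : ℝ)⁻¹ * ∑ r, J r c = 1) (h : ∀ r, J r c ≠ 0 → P r = v) :
    sigC R σ2 Γ J P c = sigU R σ2 v := by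
  rw [sigC_congr (Q := fun _ => v) h, sigC, sigU, ← Finset.sum_div, ← mul_div_assoc, hcol,
    one_div, Real.sqrt_inv, inv_inv]

lemma sigC_pos_le_sigU (hR : 0 < R) (hσ2 : 0 < σ2) (hJ : ∀ r c, 0 ≤ J r c) {P : Fin Γ → ℝ}
    {c : Fin Γ} {v : ℝ} (hcol : (Γ : ℝ)⁻¹ * ∑ r, J r c = 1) (h0 : ∀ r, 0 ≤ P r)
    (h : ∀ r, P r ≤ v) (hv : 0 ≤ v) :
    0 < sigC R σ2 Γ J P c ∧ sigC R σ2 Γ J P c ≤ sigU R σ2 v := by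
  have hle : (R * (σ2 + v))⁻¹ ≤ (Γ : ℝ)⁻¹ * ∑ r, J r c / (R * (σ2 + P r)) := by
    calc (R * (σ2 + v))⁻¹ = (Γ : ℝ)⁻¹ * ∑ r, J r c / (R * (σ2 + v)) := by
          rw [← Finset.sum_div, ← mul_div_assoc, hcol, one_div]
      _ ≤ _ := by
          refine mul_le_mul_of_nonneg_left (Finset.sum_le_sum fun r _ => ?_) (by positivity)
          have := h0 r
          exact div_le_div_of_nonneg_left (hJ r c) (by positivity)
            (mul_le_mul_of_nonneg_left (by linarith [h r]) hR.le)
  have hpos : 0 < (R * (σ2 + v))⁻¹ := by positivity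
  refine ⟨inv_pos.2 (Real.sqrt_pos.2 (hpos.trans_le hle)), ?_⟩
  rw [sigC, sigU, ← Real.sqrt_inv]
  refine Real.sqrt_le_sqrt ?_
  rw [← inv_inv (R * (σ2 + v))]
  exact inv_anti₀ hpos hle

lemma sum_shiftProf (n : ℕ) (f : ℝ → ℝ) (e : ℝ) (P : Fin (n + 1) → ℝ) :
    ∑ r, f (shiftProf (n + 1) e P r) - ∑ r, f (P r) = f e - f (P (Fin.last n)) := by
  rw [Fin.sum_univ_succ, Fin.sum_univ_castSucc (fun r => f (P r))]
  have : ∀ i : Fin n, shiftProf (n + 1) e P i.succ = P i.castSucc := fun i => by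
    simp [shiftProf, Fin.castSucc, Fin.castAdd, Fin.castLE]
  simp only [this]
  simp only [shiftProf, Fin.val_zero, if_true]
  ring

lemma sigC_shiftProf {n : ℕ} {J : Fin (n + 1) → Fin (n + 1) → ℝ} (e : ℝ) (P : Fin (n + 1) → ℝ)
    (c : Fin n) (h0 : J 0 c.succ = 0) (hlast : J (Fin.last n) c.castSucc = 0)
    (hsh : ∀ r : Fin n, J r.succ c.succ = J r.castSucc c.castSucc) :
    sigC R σ2 (n + 1) J (shiftProf (n + 1) e P) c.succ = sigC R σ2 (n + 1) J P c.castSucc := by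
  unfold sigC
  congr 3
  rw [Fin.sum_univ_succ, Fin.sum_univ_castSucc]
  have : ∀ i : Fin n, shiftProf (n + 1) e P i.succ = P i.castSucc := fun i => by
    simp [shiftProf, Fin.castSucc, Fin.castAdd, Fin.castLE]
  simp [this, h0, hlast, hsh]

/-- The change of the entropy part of the coupled potential under the shift telescopes. -/
lemma sum_entropy_shiftProf (B : ℕ) {n w : ℕ} {J : Fin (n + 1) → Fin (n + 1) → ℝ} {e Emax : ℝ}
    {E : Fin (n + 1) → ℝ} (hw : 0 < w) (hΓ : 8 * w < n + 1)
    (hJsupp : ∀ r c : Fin (n + 1), J r c ≠ 0 → r.1 ≤ c.1 + w ∧ c.1 ≤ r.1 + w)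
    (hJshift : ∀ r c : Fin n, 2 * w ≤ c.1 → c.1 + 2 * w < n →
      J r.succ c.succ = J r.castSucc c.castSucc)
    (hsym : ∀ k : Fin (n + 1), 2 * w ≤ k.1 → k.1 < n + 1 - 2 * w →
      ((n + 1 : ℕ) : ℝ)⁻¹ * ∑ r, J r k = 1)
    (rmax : Fin (n + 1)) (hrmax : 3 * w ≤ rmax.1) (hrmax' : rmax.1 + 3 * w ≤ n)
    (hleft : ∀ r : Fin (n + 1), r.1 < 3 * w → E r = e)
    (hright : ∀ r : Fin (n + 1), rmax.1 ≤ r.1 → E r = Emax) :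
    ∑ c, Su B (sigC R σ2 (n + 1) J (shiftProf (n + 1) e E) c)
      - ∑ c, Su B (sigC R σ2 (n + 1) J E c)
      = Su B (sigU R σ2 e) - Su B (sigU R σ2 Emax) := by
  set SE := shiftProf (n + 1) e E with hSE
  have hSE_left : ∀ r : Fin (n + 1), r.1 ≤ 3 * w → SE r = e := by
    intro r hr
    rw [hSE, shiftProf]
    split_ifs with h
    · rfl
    · exact hleft _ (by simp only; omega)
  have hSE_right : ∀ r : Fin (n + 1), rmax.1 < r.1 → SE r = Emax := by
    intro r hr
    rw [hSE, shiftProf, if_neg (by omega)]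
    exact hright _ (by simp only; omega)
  set S : Fin (n + 1) → ℝ := fun c => Su B (sigC R σ2 (n + 1) J E c) with hS
  set p : ℕ → ℝ := fun k =>
    if k ≤ 2 * w then Su B (sigU R σ2 e)
    else if h : k < n + 1 - 2 * w then S ⟨k - 1, by omega⟩
    else Su B (sigU R σ2 Emax) with hp
  have hstep : ∀ c : Fin (n + 1), Su B (sigC R σ2 (n + 1) J SE c) - S c = p c.1 - p (c.1 + 1) := by
    intro c
    rcases lt_trichotomy c.1 (2 * w) with hc | hc | hc
    · have : Su B (sigC R σ2 (n + 1) J SE c) = S c := by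
        refine congrArg (Su B) (sigC_congr fun r hr => ?_)
        have := hJsupp r c hr
        rw [hSE_left r (by omega), hleft r (by omega)]
      simp only [hp]
      rw [if_pos (by omega), if_pos (by omega), this]
      ring
    · have : sigC R σ2 (n + 1) J SE c = sigU R σ2 e :=
        sigC_of_eq_const (hsym c (by omega) (by omega)) fun r hr => by
          have := hJsupp r c hr
          exact hSE_left r (by omega)
      simp only [hp]
      rw [if_pos (by omega), if_neg (by omega), dif_pos (by omega), this]
      rfl
    · rcases lt_or_ge c.1 (n + 1 - 2 * w) with hc' | hc'
      · have hsh : Su B (sigC R σ2 (n + 1) J SE c) = p c.1 := by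
          simp only [hp]
          rw [if_neg (by omega), dif_pos hc']
          obtain ⟨k, rfl⟩ : ∃ k : Fin n, c = k.succ := ⟨⟨c.1 - 1, by omega⟩, by ext; simp; omega⟩
          simp only [Fin.val_succ] at hc hc' ⊢
          refine congrArg (Su B) (sigC_shiftProf e E k ?_ ?_ fun r => hJshift r k (by omega) (by omega))
          · by_contra h
            have := hJsupp _ _ h
            simp at this; omega
          · by_contra h
            have := hJsupp _ _ h
            simp at this; omega
        have hcur : S c = p (c.1 + 1) := by
          simp only [hp]
          rw [if_neg (by omega)]
          split_ifs with h
          · rfl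
          · refine congrArg (Su B) (sigC_of_eq_const (hsym c (by omega) hc') fun r hr => ?_)
            have := hJsupp r c hr
            exact hright r (by omega)
        rw [hsh, hcur]
      · have : Su B (sigC R σ2 (n + 1) J SE c) = S c := by
          refine congrArg (Su B) (sigC_congr fun r hr => ?_)
          have := hJsupp r c hr
          rw [hSE_right r (by omega), hright r (by omega)]
        simp only [hp]
        rw [if_neg (by omega), dif_neg (by omega), if_neg (by omega), dif_neg (by omega), this]
        ring
  rw [← Finset.sum_sub_distrib, Finset.sum_congr rfl fun c _ => hstep c,
    Fin.sum_univ_eq_sum_range (fun k => p k - p (k + 1)), Finset.sum_range_sub']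
  simp only [hp]
  rw [if_pos (by omega), if_neg (by omega), dif_neg (by omega)]

/-- Away from the boundary, the discretised design function has the full window in each row. -/
lemma sum_design_eq {w : ℕ} (hw : 0 < w) {g : ℝ → ℝ} (hsupp : ∀ x : ℝ, 1 < |x| → g x = 0)
    (r : Fin Γ) (h1 : w ≤ r.1) (h2 : r.1 + w < Γ) :
    ∑ c : Fin Γ, g (((r.1 : ℝ) - (c.1 : ℝ)) / (w : ℝ))
      = ∑ k ∈ Finset.Icc (-(w : ℤ)) (w : ℤ), g ((k : ℝ) / (w : ℝ)) := by
  rw [← Finset.sum_subset (Finset.subset_univ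
    (Finset.univ.filter fun c : Fin Γ => c.1 ≤ r.1 + w ∧ r.1 ≤ c.1 + w))]
  · refine Finset.sum_bij (fun c _ => (r.1 : ℤ) - c.1) ?_ ?_ ?_ ?_
    · intro c hc
      simp only [Finset.mem_filter] at hc
      rw [Finset.mem_Icc]; omega
    · intro a _ b _ hab
      ext; simpa using hab
    · intro k hk
      rw [Finset.mem_Icc] at hk
      refine ⟨⟨((r.1 : ℤ) - k).toNat, by omega⟩, ?_, ?_⟩
      · simp only [Finset.mem_filter, Finset.mem_univ, true_and]; omega
      · simp only; omega
    · intro c _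
      push_cast; rfl
  · intro c _ hc
    refine hsupp _ ?_
    have hw' : (0 : ℝ) < w := by exact_mod_cast hw
    rw [abs_div, abs_of_pos hw', one_lt_div hw']
    simp only [Finset.mem_filter, Finset.mem_univ, true_and] at hc
    have : (w : ℤ) < |(r.1 : ℤ) - c.1| := by
      rw [lt_abs]; omega
    exact_mod_cast this

end Coupling

/-- If the state evolution does not decrease `a`, and `a` lies above the MSE floor, then `a` is
outside the basin of attraction of the floor. -/
lemma notMem_basin_of_le_Tu {B : ℕ} (hB : 2 ≤ B) {R σ2 a : ℝ} (hR : 0 < R) (hσ2 : 0 < σ2)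
    (ha : 0 ≤ a) (hT : a ≤ Tu B R σ2 a) (hfloor : mseFloor B R σ2 < a) :
    a ∉ basin B R σ2 := by
  rintro ⟨-, hlim⟩
  have hge : ∀ t : ℕ, a ≤ (Tu B R σ2)^[t] a := by
    intro t
    induction t with
    | zero => exact le_rfl
    | succ t ih =>
      rw [Function.iterate_succ_apply']
      refine hT.trans (mmseB_mono_s10 hB (Real.sqrt_pos.2 (by positivity)) ?_)
      exact Real.sqrt_le_sqrt (mul_le_mul_of_nonneg_left (by linarith) hR.le)
  exact absurd (ge_of_tendsto' hlim hge) hfloor.not_ge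

/-- direct evaluation of the change of the coupled potential under
the shift: it equals `F_u(E₀) - F_u(E_max)` and is at most `-ΔF_u`. -/
theorem coupled_potential_change_direct
    (B : ℕ) (hB : 2 ≤ B) (R σ2 : ℝ) (hR : 0 < R) (hσ2 : 0 < σ2)
    (Γ w : ℕ) (hw : 0 < w) (hΓ : 8 * w < Γ)
    (g : ℝ → ℝ) (g0 gs : ℝ) (hg0 : 0 < g0) (hgs : 0 ≤ gs)
    (hsupp : ∀ x : ℝ, 1 < |x| → g x = 0)
    (hlow : ∀ x : ℝ, |x| ≤ 1 → g0 ≤ g x)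
    (hlip : ∀ x ∈ Set.Icc (-1:ℝ) 1, ∀ y ∈ Set.Icc (-1:ℝ) 1, |g x - g y| ≤ gs * |x - y|)
    (hgnorm : (2*(w:ℝ)+1)⁻¹ * ∑ k ∈ Finset.Icc (-(w:ℤ)) (w:ℤ), g ((k:ℝ)/(w:ℝ)) = 1)
    (γv : Fin Γ → ℝ) (hγ : ∀ r, 0 < γv r)
    (J : Fin Γ → Fin Γ → ℝ)
    (hJ : ∀ r c : Fin Γ, J r c = γv r * (Γ:ℝ) * g (((r.1:ℝ) - (c.1:ℝ))/(w:ℝ)) / (2*(w:ℝ)+1))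
    (hrow : ∀ r : Fin Γ, (Γ:ℝ)⁻¹ * ∑ c, J r c = 1)
    (hsym : ∀ k : Fin Γ, 2*w ≤ k.1 → k.1 < Γ - 2*w → (Γ:ℝ)⁻¹ * ∑ r, J r k = 1)
    (Estar : Fin Γ → ℝ)
    (hstarbox : ∀ r, Estar r ∈ Set.Icc (0:ℝ) 1)
    (hpin : ∀ r : Fin Γ, (r.1 < 3*w ∨ Γ - 3*w ≤ r.1) → Estar r = 0)
    (hfixstar : ∀ r : Fin Γ, ¬(r.1 < 3*w ∨ Γ - 3*w ≤ r.1) → Tc B R σ2 Γ J Estar r = Estar r)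
    (E : Fin Γ → ℝ) (rstar rmax : Fin Γ) (Emax : ℝ)
    (hbox : ∀ r, E r ∈ Set.Icc (0:ℝ) 1)
    (hmono : ∀ r r' : Fin Γ, r ≤ r' → E r ≤ E r')
    (hrsm : rstar ≤ rmax)
    (hrmaxloc : rmax.1 + 1 ≤ Γ - 3*w)
    (hplat0 : ∀ r, r ≤ rstar → E r = mseFloor B R σ2)
    (hplatmax : ∀ r, rmax ≤ r → E r = Emax)
    (hmid : ∀ r : Fin Γ, rstar ≤ r → r ≤ rmax → E r = Estar r)
    (hEmaxatt : Estar rmax = Emax)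
    (hEmaxub : ∀ r, Estar r ≤ Emax)
    (hdeg : ∀ r, Estar r ≤ E r)
    (hstrict : (∀ r, mseFloor B R σ2 ≤ E r) ∧ ∃ r, mseFloor B R σ2 < E r) :
    Fc B R σ2 Γ J (shiftProf Γ (mseFloor B R σ2) E) - Fc B R σ2 Γ J E =
      -Fu B R σ2 Emax + Fu B R σ2 (mseFloor B R σ2) ∧
    ((Fc B R σ2 Γ J (shiftProf Γ (mseFloor B R σ2) E) - Fc B R σ2 Γ J E : ℝ) : EReal) ≤
      -gapFu B R σ2 := by
  set e := mseFloor B R σ2 with he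
  obtain ⟨n, rfl⟩ : ∃ n, Γ = n + 1 := ⟨Γ - 1, by omega⟩
  have hw' : (0 : ℝ) < w := by exact_mod_cast hw
  have hΓ' : ((n + 1 : ℕ) : ℝ) ≠ 0 := by positivity
  have hrmax_le : ∀ r, E r ≤ Emax := fun r =>
    (hmono r _ (Fin.le_last r)).trans_eq (hplatmax _ (Fin.le_last _))
  have he0 : 0 ≤ e := by rw [← hplat0 rstar le_rfl]; exact (hbox _).1
  have hfloor : e < Emax := by
    obtain ⟨r, hr⟩ := hstrict.2
    exact hr.trans_le (hrmax_le r)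
  have hrmax : 3 * w ≤ rmax.1 := by
    by_contra! h
    have := hpin rmax (Or.inl h)
    linarith
  have hleft : ∀ r : Fin (n + 1), r.1 < 3 * w → E r = e := by
    intro r hr
    rcases le_total r rstar with h | h
    · exact hplat0 r h
    · have hrm : r ≤ rmax := Fin.le_def.2 (by omega)
      have h1 : E r = 0 := by rw [hmid r h hrm, hpin r (Or.inl hr)]
      linarith [hstrict.1 r]
  have hgnn : ∀ x, 0 ≤ g x := by
    intro x
    rcases le_or_gt |x| 1 with h | h
    · exact hg0.le.trans (hlow x h)
    · exact (hsupp x h).ge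
  have hJnn : ∀ r c, 0 ≤ J r c := fun r c => by
    rw [hJ]
    have := hγ r
    have := hgnn (((r.1:ℝ) - (c.1:ℝ))/(w:ℝ))
    positivity
  have hJsupp : ∀ r c : Fin (n + 1), J r c ≠ 0 → r.1 ≤ c.1 + w ∧ c.1 ≤ r.1 + w := by
    intro r c
    contrapose!
    intro h
    rw [hJ, hsupp, mul_zero, zero_div]
    rw [abs_div, abs_of_pos hw', one_lt_div hw']
    have : (w : ℤ) < |(r.1 : ℤ) - c.1| := by
      rw [lt_abs]; omega
    exact_mod_cast this
  have hγ1 : ∀ r : Fin (n + 1), w ≤ r.1 → r.1 + w < n + 1 → γv r = 1 := by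
    intro r h1 h2
    have h := hrow r
    simp_rw [hJ] at h
    rw [← Finset.sum_div, ← Finset.mul_sum, sum_design_eq hw hsupp r h1 h2] at h
    rw [← h]
    calc γv r = γv r * ((2*(w:ℝ)+1)⁻¹ * ∑ k ∈ Finset.Icc (-(w:ℤ)) (w:ℤ), g ((k:ℝ)/(w:ℝ))) := by
          rw [hgnorm, mul_one]
      _ = _ := by field_simp
  have hJshift : ∀ r c : Fin n, 2 * w ≤ c.1 → c.1 + 2 * w < n →
      J r.succ c.succ = J r.castSucc c.castSucc := by
    intro r c hc1 hc2
    by_cases h : r.1 ≤ c.1 + w ∧ c.1 ≤ r.1 + w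
    · rw [hJ, hJ, hγ1 r.succ (by simp; omega) (by simp; omega),
        hγ1 r.castSucc (by simp; omega) (by simp; omega)]
      simp
    · have h1 : J r.succ c.succ = 0 := by
        by_contra h1
        have := hJsupp _ _ h1
        simp at this; omega
      have h2 : J r.castSucc c.castSucc = 0 := by
        by_contra h2
        have := hJsupp _ _ h2
        simp at this; omega
      rw [h1, h2]
  have hSsum := sum_entropy_shiftProf B (R := R) (σ2 := σ2) hw hΓ hJsupp hJshift hsym rmax hrmax
    (by omega) hleft fun r hr => hplatmax r (Fin.le_def.2 hr)
  have hU := sum_shiftProf n (Uu R σ2) e E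
  rw [hplatmax _ (Fin.le_last _)] at hU
  have hchange : Fc B R σ2 (n + 1) J (shiftProf (n + 1) e E) - Fc B R σ2 (n + 1) J E
      = -Fu B R σ2 Emax + Fu B R σ2 e := by
    simp only [Fc, Fu]
    linarith [hU, hSsum]
  refine ⟨hchange, ?_⟩
  have hEmax_mem : Emax ∈ Set.Icc (0 : ℝ) 1 := hEmaxatt ▸ hstarbox rmax
  have hTu : Emax ≤ Tu B R σ2 Emax := by
    calc Emax = Tc B R σ2 (n + 1) J Estar rmax := by
          rw [hfixstar rmax (by omega), hEmaxatt]
      _ ≤ ((n + 1 : ℕ) : ℝ)⁻¹ * ∑ c, J rmax c * Tu B R σ2 Emax := by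
          refine mul_le_mul_of_nonneg_left (Finset.sum_le_sum fun c _ => ?_) (by positivity)
          by_cases hc : J rmax c = 0
          · simp [hc]
          · have := hJsupp _ _ hc
            obtain ⟨h1, h2⟩ := sigC_pos_le_sigU hR hσ2 hJnn (P := Estar) (c := c)
              (hsym c (by omega) (by omega)) (fun r => (hstarbox r).1) hEmaxub hEmax_mem.1
            exact mul_le_mul_of_nonneg_left (mmseB_mono_s10 hB h1 h2) (hJnn _ _)
      _ = Tu B R σ2 Emax := by
          rw [← Finset.sum_mul, ← mul_assoc, hrow, one_mul]
  have hout := notMem_basin_of_le_Tu hB hR hσ2 hEmax_mem.1 hTu hfloor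
  have hgap : gapFu B R σ2 ≤ ((Fu B R σ2 Emax - Fu B R σ2 e : ℝ) : EReal) :=
    iInf₂_le Emax ⟨hEmax_mem, hout⟩
  rw [hchange, EReal.le_neg, ← EReal.coe_neg]
  refine hgap.trans_eq ?_
  congr 1
  ring
end
end

section
/- Large section size limit of the underlying potential: for every fixed E ∈ [0,1], R > 0 and σ² > 0, lim_{B→∞} F_u(E; B) = U_u(E) − max(0, 1 − 1/(2·ln(2)·Σ(E)²)), where Σ(E)² = R(σ² + E). -/
open MeasureTheory ProbabilityTheory Filter Finset Real

noncomputable section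

/-- First absolute moment of the standard Gaussian. -/
def gaussAbsMoment : ℝ := ∫ x, |x| ∂ gaussianReal 0 1

lemma integrable_abs_gaussianReal : Integrable (fun x : ℝ => |x|) (gaussianReal 0 1) := by
  have h := (memLp_id_gaussianReal (μ := 0) (v := 1) 1).integrable (by norm_num)
  exact h.abs

lemma integral_exp_mul_gaussianReal_zero_one (a : ℝ) :
    ∫ x, Real.exp (a * x) ∂ gaussianReal 0 1 = Real.exp (a ^ 2 / 2) := by
  have h := congrFun (mgf_id_gaussianReal (μ := 0) (v := 1)) a
  simpa [mgf] using h

/-- Lower bound on the Gaussian upper tail. -/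
lemma gaussianReal_real_Ici_ge {a : ℝ} (ha : 0 ≤ a) :
    (√(2 * π))⁻¹ * Real.exp (-(a + 1) ^ 2 / 2) ≤ (gaussianReal 0 1).real (Set.Ici a) := by
  have h1 : (gaussianReal 0 1).real (Set.Icc a (a + 1)) ≤ (gaussianReal 0 1).real (Set.Ici a) :=
    measureReal_mono Set.Icc_subset_Ici_self
  refine le_trans ?_ h1
  rw [measureReal_def, gaussianReal_apply_eq_integral 0 one_ne_zero, ENNReal.toReal_ofReal
    (integral_nonneg fun x => gaussianPDFReal_nonneg _ _ _)]
  have hc : ∫ _ in Set.Icc a (a + 1), (√(2 * π))⁻¹ * Real.exp (-(a + 1) ^ 2 / 2)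
      = (√(2 * π))⁻¹ * Real.exp (-(a + 1) ^ 2 / 2) := by
    simp
  rw [← hc]
  refine setIntegral_mono_on (integrableOn_const (by simp)) (integrable_gaussianPDFReal 0 1).integrableOn
    measurableSet_Icc fun x hx => ?_
  rw [gaussianPDFReal]
  simp only [NNReal.coe_one, mul_one, sub_zero]
  gcongr
  · linarith [hx.1]
  · exact hx.2

/-- A second-moment lower bound on the logarithm. -/
lemma log_one_add_ge {N m : ℝ} (hN : 0 ≤ N) (hm : 2 ≤ m) :
    Real.log (m / 2) * (1 - 4 / m ^ 2 * (N - m) ^ 2) ≤ Real.log (1 + N) := by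
  have hL : 0 ≤ Real.log (m / 2) := Real.log_nonneg (by linarith)
  by_cases h : N < m / 2
  · have h4 : 1 ≤ 4 / m ^ 2 * (N - m) ^ 2 := by
      rw [div_mul_eq_mul_div, le_div_iff₀ (by positivity)]
      nlinarith
    have h5 : 0 ≤ Real.log (1 + N) := Real.log_nonneg (by linarith)
    nlinarith
  · have h4 : 0 ≤ 4 / m ^ 2 * (N - m) ^ 2 := by positivity
    have h5 : Real.log (m / 2) ≤ Real.log (1 + N) :=
      Real.log_le_log (by linarith) (by linarith)
    nlinarith

section GaussianSection

variable {ι : Type*}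

/-- Number of coordinates in `s` exceeding the level `a`. -/
def exceedCount (s : Finset ι) (a : ℝ) (z : ι → ℝ) : ℝ :=
  ∑ i ∈ s, (Set.Ici a).indicator (fun _ => (1 : ℝ)) (z i)

/-- The partition sum `∑_{i ∈ s} exp(a zᵢ - a²)`. -/
def partSum (s : Finset ι) (a : ℝ) (z : ι → ℝ) : ℝ :=
  ∑ i ∈ s, Real.exp (a * z i - a ^ 2)

lemma partSum_nonneg (s : Finset ι) (a : ℝ) (z : ι → ℝ) : 0 ≤ partSum s a z :=
  Finset.sum_nonneg fun _ _ => (Real.exp_pos _).le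

lemma exceedCount_nonneg (s : Finset ι) (a : ℝ) (z : ι → ℝ) : 0 ≤ exceedCount s a z :=
  Finset.sum_nonneg fun _ _ => Set.indicator_nonneg (fun _ _ => zero_le_one) _

lemma exceedCount_le_partSum (s : Finset ι) {a : ℝ} (ha : 0 ≤ a) (z : ι → ℝ) :
    exceedCount s a z ≤ partSum s a z := by
  refine Finset.sum_le_sum fun i _ => ?_
  by_cases h : z i ∈ Set.Ici a
  · rw [Set.indicator_of_mem h]
    refine Real.one_le_exp ?_
    have : a ≤ z i := h
    nlinarith
  · rw [Set.indicator_of_notMem h]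
    positivity

/-- The logarithmic entropy integrand of the effective channel. -/
def logPart (s : Finset ι) (a : ℝ) (i₀ : ι) (z : ι → ℝ) : ℝ :=
  Real.log (1 + ∑ i ∈ s, Real.exp ((z i - z i₀) * a - a ^ 2))

lemma logPart_eq (s : Finset ι) (a : ℝ) (i₀ : ι) (z : ι → ℝ) :
    logPart s a i₀ z = Real.log (1 + Real.exp (-(a * z i₀)) * partSum s a z) := by
  rw [logPart, partSum, Finset.mul_sum]
  congr 2
  refine Finset.sum_congr rfl fun i _ => ?_
  rw [← Real.exp_add]
  congr 1; ring

lemma logPart_nonneg (s : Finset ι) (a : ℝ) (i₀ : ι) (z : ι → ℝ) : 0 ≤ logPart s a i₀ z :=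
  Real.log_nonneg (le_add_of_nonneg_right (Finset.sum_nonneg fun _ _ => (Real.exp_pos _).le))

lemma logPart_le (s : Finset ι) {a : ℝ} (ha : 0 ≤ a) (i₀ : ι) (z : ι → ℝ) :
    logPart s a i₀ z ≤ a * |z i₀| + Real.log (1 + partSum s a z) := by
  have hY := partSum_nonneg s a z
  rw [logPart_eq, ← Real.log_exp (a * |z i₀|), ← Real.log_mul (by positivity) (by positivity)]
  refine Real.log_le_log (by positivity) ?_
  have h1 : 1 ≤ Real.exp (a * |z i₀|) := Real.one_le_exp (by positivity)
  have h2 : Real.exp (-(a * z i₀)) ≤ Real.exp (a * |z i₀|) := by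
    refine Real.exp_le_exp.2 ?_
    nlinarith [neg_abs_le (z i₀)]
  nlinarith [mul_le_mul_of_nonneg_right h2 hY]

lemma le_logPart (s : Finset ι) {a : ℝ} (ha : 0 ≤ a) (i₀ : ι) (z : ι → ℝ) :
    Real.log (1 + partSum s a z) - a * |z i₀| ≤ logPart s a i₀ z := by
  have hY := partSum_nonneg s a z
  rw [logPart_eq, ← Real.log_exp (a * |z i₀|), ← Real.log_div (by positivity) (by positivity),
    div_eq_mul_inv, ← Real.exp_neg]
  refine Real.log_le_log (by positivity) ?_
  have h1 : Real.exp (-(a * |z i₀|)) ≤ 1 := Real.exp_le_one_iff.2 (by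
    have : 0 ≤ a * |z i₀| := by positivity
    linarith)
  have h2 : Real.exp (-(a * |z i₀|)) ≤ Real.exp (-(a * z i₀)) := by
    refine Real.exp_le_exp.2 ?_
    nlinarith [le_abs_self (z i₀)]
  nlinarith [mul_le_mul_of_nonneg_right h2 hY]

variable [Fintype ι]

lemma measurable_indicator_Ici (a : ℝ) :
    Measurable ((Set.Ici a).indicator (fun _ => (1 : ℝ))) :=
  measurable_const.indicator measurableSet_Ici

lemma memLp_indicator_eval (a : ℝ) (i : ι) :
    MemLp (fun z : ι → ℝ => (Set.Ici a).indicator (fun _ => (1 : ℝ)) (z i)) 2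
      (Measure.pi fun _ : ι => gaussianReal 0 1) := by
  refine MemLp.of_bound
    ((measurable_indicator_Ici a).comp (measurable_pi_apply i)).aestronglyMeasurable 1 ?_
  refine ae_of_all _ fun z => ?_
  by_cases h : z i ∈ Set.Ici a <;> simp [h]

lemma integral_indicator_eval (a : ℝ) (i : ι) :
    ∫ z : ι → ℝ, (Set.Ici a).indicator (fun _ => (1 : ℝ)) (z i)
      ∂ (Measure.pi fun _ : ι => gaussianReal 0 1) = (gaussianReal 0 1).real (Set.Ici a) := by
  rw [integral_comp_eval (μ := fun _ : ι => gaussianReal 0 1) (i := i)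
    (measurable_indicator_Ici a).aestronglyMeasurable]
  simp [integral_indicator, measurableSet_Ici]

lemma memLp_exceedCount (s : Finset ι) (a : ℝ) :
    MemLp (exceedCount s a) 2 (Measure.pi fun _ : ι => gaussianReal 0 1) :=
  memLp_finsetSum s fun i _ => memLp_indicator_eval a i

lemma integral_exceedCount (s : Finset ι) (a : ℝ) :
    ∫ z, exceedCount s a z ∂ (Measure.pi fun _ : ι => gaussianReal 0 1)
      = #s * (gaussianReal 0 1).real (Set.Ici a) := by
  unfold exceedCount
  rw [integral_finsetSum _ fun i _ => (memLp_indicator_eval a i).integrable one_le_two]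
  simp [integral_indicator_eval]

lemma integral_sq_exceedCount_sub_le (s : Finset ι) (a : ℝ) :
    ∫ z, (exceedCount s a z - #s * (gaussianReal 0 1).real (Set.Ici a)) ^ 2
      ∂ (Measure.pi fun _ : ι => gaussianReal 0 1)
      ≤ #s * (gaussianReal 0 1).real (Set.Ici a) := by
  rw [← integral_exceedCount, ← variance_eq_integral (memLp_exceedCount s a).aemeasurable,
    integral_exceedCount]
  have hfun : exceedCount s a = ∑ i ∈ s, fun z : ι → ℝ =>
      (Set.Ici a).indicator (fun _ => (1 : ℝ)) (z i) := by
    ext z; simp [exceedCount]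
  rw [hfun, IndepFun.variance_sum (fun i _ => memLp_indicator_eval a i)]
  · rw [← nsmul_eq_mul]
    refine Finset.sum_le_card_nsmul _ _ _ fun i _ => ?_
    refine (variance_le_expectation_sq (memLp_indicator_eval a i).aestronglyMeasurable).trans ?_
    rw [← integral_indicator_eval a i]
    refine le_of_eq (integral_congr_ae (ae_of_all _ fun z => ?_))
    by_cases h : z i ∈ Set.Ici a <;> simp [h]
  · intro i _ j _ hij
    exact (iIndepFun_pi (μ := fun _ : ι => gaussianReal 0 1)
      (X := fun _ => (Set.Ici a).indicator (fun _ => (1 : ℝ)))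
      fun _ => (measurable_indicator_Ici a).aemeasurable).indepFun hij

lemma integrable_exp_eval (a : ℝ) (i : ι) :
    Integrable (fun z : ι → ℝ => Real.exp (a * z i - a ^ 2))
      (Measure.pi fun _ : ι => gaussianReal 0 1) := by
  have h := integrable_exp_mul_gaussianReal (μ := 0) (v := 1) a
  simp_rw [Real.exp_sub]
  exact (integrable_comp_eval (μ := fun _ : ι => gaussianReal 0 1) (i := i) h).div_const _

lemma integrable_partSum (s : Finset ι) (a : ℝ) :
    Integrable (partSum s a) (Measure.pi fun _ : ι => gaussianReal 0 1) :=
  integrable_finsetSum s fun i _ => integrable_exp_eval a i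

lemma integral_partSum (s : Finset ι) (a : ℝ) :
    ∫ z, partSum s a z ∂ (Measure.pi fun _ : ι => gaussianReal 0 1)
      = #s * Real.exp (-(a ^ 2 / 2)) := by
  unfold partSum
  rw [integral_finsetSum _ fun i _ => integrable_exp_eval a i]
  have h (i : ι) : ∫ z : ι → ℝ, Real.exp (a * z i - a ^ 2)
      ∂ (Measure.pi fun _ : ι => gaussianReal 0 1) = Real.exp (-(a ^ 2 / 2)) := by
    simp_rw [Real.exp_sub]
    rw [integral_div, integral_comp_eval (μ := fun _ : ι => gaussianReal 0 1) (i := i)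
      (f := fun x => Real.exp (a * x)) (by fun_prop), integral_exp_mul_gaussianReal_zero_one,
      ← Real.exp_sub]
    congr 1; ring
  simp [h]

lemma integrable_abs_eval (i : ι) :
    Integrable (fun z : ι → ℝ => |z i|) (Measure.pi fun _ : ι => gaussianReal 0 1) :=
  integrable_comp_eval (μ := fun _ : ι => gaussianReal 0 1) (i := i) integrable_abs_gaussianReal

lemma integral_abs_eval (i : ι) :
    ∫ z : ι → ℝ, |z i| ∂ (Measure.pi fun _ : ι => gaussianReal 0 1) = gaussAbsMoment :=
  integral_comp_eval (μ := fun _ : ι => gaussianReal 0 1) (i := i)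
    integrable_abs_gaussianReal.aestronglyMeasurable

lemma integrable_logPart (s : Finset ι) {a : ℝ} (ha : 0 ≤ a) (i₀ : ι) :
    Integrable (logPart s a i₀) (Measure.pi fun _ : ι => gaussianReal 0 1) := by
  refine (((integrable_abs_eval i₀).const_mul a).add (integrable_partSum s a)).mono' ?_ ?_
  · exact Measurable.aestronglyMeasurable (by unfold logPart; fun_prop)
  · refine ae_of_all _ fun z => ?_
    rw [Real.norm_of_nonneg (logPart_nonneg s a i₀ z)]
    refine (logPart_le s ha i₀ z).trans ?_
    have hY := partSum_nonneg s a z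
    have := Real.log_le_sub_one_of_pos (show 0 < 1 + partSum s a z by positivity)
    simp only [Pi.add_apply]
    linarith

/-- Annealed upper bound on the expected entropy integrand. -/
lemma integral_logPart_le (s : Finset ι) {a : ℝ} (ha : 0 ≤ a) (i₀ : ι) :
    ∫ z, logPart s a i₀ z ∂ (Measure.pi fun _ : ι => gaussianReal 0 1)
      ≤ a * gaussAbsMoment + Real.log (1 + #s * Real.exp (-(a ^ 2 / 2))) := by
  set t : ℝ := 1 + #s * Real.exp (-(a ^ 2 / 2)) with ht
  have htpos : 0 < t := by positivity
  have hpt (z : ι → ℝ) : logPart s a i₀ z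
      ≤ a * |z i₀| + (Real.log t - 1 + t⁻¹ + t⁻¹ * partSum s a z) := by
    have hY := partSum_nonneg s a z
    refine (logPart_le s ha i₀ z).trans ?_
    have h := Real.log_le_sub_one_of_pos (show 0 < (1 + partSum s a z) / t by positivity)
    rw [Real.log_div (by positivity) htpos.ne', div_eq_mul_inv] at h
    linarith
  have hi1 := (integrable_abs_eval i₀).const_mul a
  have hi2 := (integrable_partSum s a).const_mul t⁻¹
  have hi3 := (integrable_const (μ := Measure.pi fun _ : ι => gaussianReal 0 1)
    (Real.log t - 1 + t⁻¹)).add hi2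
  refine (integral_mono (integrable_logPart s ha i₀) (hi1.add hi3) hpt).trans (le_of_eq ?_)
  rw [integral_add' hi1 hi3, integral_add' (integrable_const _) hi2, integral_const_mul,
    integral_const_mul, integral_abs_eval, integral_partSum]
  simp only [integral_const, probReal_univ, smul_eq_mul, one_mul]
  have : t⁻¹ * (#s * Real.exp (-(a ^ 2 / 2))) = 1 - t⁻¹ := by
    rw [show (#s : ℝ) * Real.exp (-(a ^ 2 / 2)) = t - 1 by rw [ht]; ring]
    field_simp
  rw [this]; ring

/-- Second-moment lower bound on the expected entropy integrand. -/
lemma le_integral_logPart (s : Finset ι) {a M : ℝ} (ha : 0 ≤ a) (i₀ : ι) (hM : 4 ≤ M)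
    (hMs : M ≤ #s * (gaussianReal 0 1).real (Set.Ici a)) :
    Real.log (M / 2) * (1 - 4 / M) - a * gaussAbsMoment
      ≤ ∫ z, logPart s a i₀ z ∂ (Measure.pi fun _ : ι => gaussianReal 0 1) := by
  have hV := integral_sq_exceedCount_sub_le s a
  set m : ℝ := #s * (gaussianReal 0 1).real (Set.Ici a) with hm
  have hm4 : 4 ≤ m := hM.trans hMs
  have hL : 0 ≤ Real.log (m / 2) := Real.log_nonneg (by linarith)
  have hpt (z : ι → ℝ) : Real.log (m / 2) * (1 - 4 / m ^ 2 * (exceedCount s a z - m) ^ 2)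
      - a * |z i₀| ≤ logPart s a i₀ z := by
    refine le_trans ?_ (le_logPart s ha i₀ z)
    refine sub_le_sub_right ?_ _
    refine (log_one_add_ge (exceedCount_nonneg s a z) (by linarith)).trans ?_
    have h0 := exceedCount_nonneg s a z
    exact Real.log_le_log (by positivity) (by linarith [exceedCount_le_partSum s ha z])
  have hi1 := (integrable_abs_eval i₀).const_mul a
  have hi2 := ((((memLp_exceedCount s a).sub (memLp_const m)).integrable_sq).const_mul
    (4 / m ^ 2))
  have hi3 := (integrable_const (μ := Measure.pi fun _ : ι => gaussianReal 0 1) (1 : ℝ)).sub hi2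
  have hi4 := hi3.const_mul (Real.log (m / 2))
  refine le_trans ?_ (integral_mono (hi4.sub hi1) (integrable_logPart s ha i₀) hpt)
  rw [integral_sub' hi4 hi1, integral_const_mul, integral_sub' (integrable_const _) hi2,
    integral_const_mul, integral_const_mul, integral_abs_eval]
  simp only [integral_const, probReal_univ, smul_eq_mul, one_mul, Pi.sub_apply]
  refine sub_le_sub_right ?_ _
  refine mul_le_mul (Real.log_le_log (by linarith) (by linarith)) ?_ ?_ hL
  · refine sub_le_sub_left ?_ _
    calc 4 / m ^ 2 * ∫ z, (exceedCount s a z - m) ^ 2 ∂ (Measure.pi fun _ : ι => gaussianReal 0 1)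
        ≤ 4 / m ^ 2 * m := by gcongr
      _ = 4 / m := by field_simp
      _ ≤ 4 / M := by gcongr
  · rw [sub_nonneg, div_le_one (by linarith)]
    exact hM

end GaussianSection

lemma Su_eq {B : ℕ} (hB : 0 < B) (Sn : ℝ) :
    Su B Sn = (∫ z, logPart (Finset.univ.erase (⟨0, hB⟩ : Fin B))
      (√(Real.logb 2 B) / Sn) ⟨0, hB⟩ z ∂ (Measure.pi fun _ : Fin B => gaussianReal 0 1))
        / Real.log B := by
  have : NeZero B := ⟨hB.ne'⟩
  have h2 : 0 ≤ Real.logb 2 B :=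
    Real.logb_nonneg (by norm_num) (by exact_mod_cast hB)
  rw [Su, dif_pos hB, ← integral_div]
  simp only [logPart, Real.logb, stdGauss, div_pow] at h2 ⊢
  rw [Real.sq_sqrt h2]
  simp only [mul_div_assoc]
  rfl

lemma tendsto_entropy_upper (c d L : ℝ) :
    Tendsto (fun r : ℝ => (r * c + (d + r ^ 2 * L)) / r ^ 2) atTop (nhds L) := by
  have h : Tendsto (fun r : ℝ => r⁻¹ * c + (r⁻¹ * r⁻¹ * d + L)) atTop
      (nhds (0 * c + (0 * 0 * d + L))) :=
    (tendsto_inv_atTop_zero.mul_const c).add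
      (((tendsto_inv_atTop_zero.mul tendsto_inv_atTop_zero).mul_const d).add_const L)
  simp only [zero_mul, zero_add] at h
  refine h.congr' ?_
  filter_upwards [eventually_gt_atTop 0] with r hr
  field_simp

/-- Logarithm of the lower bound on the mean number of exceedances. -/
def logCount (β r : ℝ) : ℝ :=
  r ^ 2 - Real.log 2 + (Real.log (√(2 * π))⁻¹ - (β * r + 1) ^ 2 / 2)

lemma tendsto_logCount_div (β : ℝ) :
    Tendsto (fun r : ℝ => logCount β r / r ^ 2) atTop (nhds (1 - β ^ 2 / 2)) := by
  refine (tendsto_entropy_upper (-β) (Real.log (√(2 * π))⁻¹ - Real.log 2 - 1 / 2)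
    (1 - β ^ 2 / 2)).congr fun r => ?_
  rw [logCount]
  congr 1; ring

lemma tendsto_logCount {β : ℝ} (hβ : 0 < 1 - β ^ 2 / 2) :
    Tendsto (logCount β) atTop atTop := by
  have h := (tendsto_logCount_div β).pos_mul_atTop hβ (tendsto_pow_atTop (n := 2) (by norm_num))
  refine h.congr' ?_
  filter_upwards [eventually_gt_atTop 0] with r hr
  field_simp

lemma tendsto_entropy_lower {β : ℝ} (hβ : 0 < 1 - β ^ 2 / 2) (C : ℝ) :
    Tendsto (fun r : ℝ => (Real.log (Real.exp (logCount β r) / 2)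
      * (1 - 4 / Real.exp (logCount β r)) - β * r * C) / r ^ 2) atTop
      (nhds (1 - β ^ 2 / 2)) := by
  have h1 : Tendsto (fun r : ℝ => 1 - 4 / Real.exp (logCount β r)) atTop (nhds (1 - 0)) :=
    ((Real.tendsto_exp_atTop.comp (tendsto_logCount hβ)).const_div_atTop 4).const_sub 1
  have h2 : Tendsto (fun r : ℝ => (r * 0 + (-Real.log 2 + r ^ 2 * 0)) / r ^ 2) atTop (nhds 0) :=
    tendsto_entropy_upper 0 (-Real.log 2) 0
  have h3 : Tendsto (fun r : ℝ => (r * (-(β * C)) + (0 + r ^ 2 * 0)) / r ^ 2) atTop (nhds 0) :=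
    tendsto_entropy_upper (-(β * C)) 0 0
  have h := (((tendsto_logCount_div β).add h2).mul h1).add h3
  simp only [sub_zero, add_zero, mul_one] at h
  refine h.congr fun r => ?_
  rw [Real.log_div (Real.exp_pos _).ne' two_ne_zero, Real.log_exp]
  ring

/-- Large section size limit of the entropy term. -/
lemma tendsto_Su {Sn : ℝ} (hSn : 0 < Sn) :
    Tendsto (fun B : ℕ => Su B Sn) atTop
      (nhds (max 0 (1 - 1 / (2 * Real.log 2 * Sn ^ 2)))) := by
  have hl2 : 0 < Real.log 2 := Real.log_pos one_lt_two
  set β : ℝ := (√(Real.log 2) * Sn)⁻¹ with hβdef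
  have hβ : 0 < β := by positivity
  have hβ2 : 1 / (2 * Real.log 2 * Sn ^ 2) = β ^ 2 / 2 := by
    rw [hβdef, inv_pow, mul_pow, Real.sq_sqrt hl2.le]
    field_simp
  rw [hβ2]
  set r : ℕ → ℝ := fun B => √(Real.log B) with hr
  have hrtop : Tendsto r atTop atTop :=
    Real.tendsto_sqrt_atTop.comp (Real.tendsto_log_atTop.comp tendsto_natCast_atTop_atTop)
  have ha (B : ℕ) : √(Real.logb 2 B) / Sn = β * r B := by
    rw [Real.logb, Real.sqrt_div' _ hl2.le, hβdef, hr]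
    field_simp
  have hrsq (B : ℕ) : r B ^ 2 = Real.log B :=
    Real.sq_sqrt (Real.log_natCast_nonneg B)
  have hexp {B : ℕ} (hB : 2 ≤ B) : Real.exp (r B ^ 2) = B := by
    rw [hrsq B, Real.exp_log (by positivity)]
  have hupper : ∀ᶠ B : ℕ in atTop, Su B Sn ≤ (r B * (β * gaussAbsMoment)
      + (Real.log 2 + r B ^ 2 * max 0 (1 - β ^ 2 / 2))) / r B ^ 2 := by
    filter_upwards [eventually_ge_atTop 2] with B hB
    have hB0 : 0 < B := by lia
    rw [Su_eq hB0, ha, ← hrsq B]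
    have hr0 : 0 ≤ r B := Real.sqrt_nonneg _
    refine div_le_div_of_nonneg_right ?_ (sq_nonneg _)
    refine (integral_logPart_le _ (by positivity) _).trans ?_
    have h1 : (1 : ℝ) ≤ Real.exp (r B ^ 2 * max 0 (1 - β ^ 2 / 2)) :=
      Real.one_le_exp (by positivity)
    have h2 : (#(Finset.univ.erase (⟨0, hB0⟩ : Fin B)) : ℝ) * Real.exp (-((β * r B) ^ 2 / 2))
        ≤ Real.exp (r B ^ 2 * max 0 (1 - β ^ 2 / 2)) := by
      have h3 : (#(Finset.univ.erase (⟨0, hB0⟩ : Fin B)) : ℝ) ≤ Real.exp (r B ^ 2) := by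
        rw [hexp hB]
        exact_mod_cast (Finset.card_le_univ _).trans_eq (Fintype.card_fin B)
      refine (mul_le_mul_of_nonneg_right h3 (Real.exp_pos _).le).trans ?_
      rw [← Real.exp_add]
      refine Real.exp_le_exp.2 ?_
      have := mul_le_mul_of_nonneg_left (le_max_right 0 (1 - β ^ 2 / 2)) (sq_nonneg (r B))
      nlinarith
    have h4 : Real.log (1 + #(Finset.univ.erase (⟨0, hB0⟩ : Fin B))
        * Real.exp (-((β * r B) ^ 2 / 2)))
        ≤ Real.log 2 + r B ^ 2 * max 0 (1 - β ^ 2 / 2) := by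
      rw [← Real.log_exp (r B ^ 2 * max 0 (1 - β ^ 2 / 2)),
        ← Real.log_mul two_ne_zero (Real.exp_pos _).ne']
      exact Real.log_le_log (by positivity) (by linarith)
    linarith
  have hU := (tendsto_entropy_upper (β * gaussAbsMoment) (Real.log 2)
    (max 0 (1 - β ^ 2 / 2))).comp hrtop
  by_cases hκ : 0 < 1 - β ^ 2 / 2
  · have hLo := (tendsto_entropy_lower hκ gaussAbsMoment).comp hrtop
    rw [max_eq_right hκ.le] at hU hupper ⊢
    refine tendsto_of_tendsto_of_tendsto_of_le_of_le' hLo hU ?_ hupper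
    filter_upwards [eventually_ge_atTop 2,
      ((Real.tendsto_exp_atTop.comp (tendsto_logCount hκ)).comp hrtop).eventually_ge_atTop 4]
      with B hB h4
    have hB0 : 0 < B := by lia
    have hr0 : 0 ≤ r B := Real.sqrt_nonneg _
    rw [Su_eq hB0, ha, ← hrsq B]
    refine div_le_div_of_nonneg_right ?_ (sq_nonneg _)
    refine le_integral_logPart _ (by positivity) _ h4 ?_
    have hcard : (B : ℝ) / 2 ≤ #(Finset.univ.erase (⟨0, hB0⟩ : Fin B)) := by
      rw [Finset.card_erase_of_mem (Finset.mem_univ _), Finset.card_univ, Fintype.card_fin,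
        Nat.cast_sub (by lia)]
      have : (2 : ℝ) ≤ B := by exact_mod_cast hB
      push_cast
      linarith
    refine le_trans (le_of_eq ?_) (mul_le_mul hcard
      (gaussianReal_real_Ici_ge (by positivity)) (by positivity) (by positivity))
    rw [logCount, Real.exp_add, Real.exp_sub, hexp hB, Real.exp_log two_pos, sub_eq_add_neg,
      Real.exp_add, Real.exp_log (by positivity), neg_div]
  · rw [max_eq_left (not_lt.1 hκ)] at hU hupper ⊢
    refine tendsto_of_tendsto_of_tendsto_of_le_of_le' tendsto_const_nhds hU ?_ hupper
    filter_upwards [eventually_ge_atTop 2] with B hB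
    rw [Su_eq (by lia)]
    exact div_nonneg (integral_nonneg fun z => logPart_nonneg _ _ _ z)
      (Real.log_natCast_nonneg B)

/-- large section size limit of the underlying potential. -/
theorem large_B_limit_of_potential
    (R σ2 : ℝ) (hR : 0 < R) (hσ2 : 0 < σ2)
    (E : ℝ) (hE : E ∈ Set.Icc (0:ℝ) 1) :
    Tendsto (fun B : ℕ => Fu B R σ2 E) atTop
      (nhds (Uu R σ2 E - max 0 (1 - 1 / (2 * Real.log 2 * (R * (σ2 + E)))))) := by
  have hpos : 0 < R * (σ2 + E) := mul_pos hR (by linarith [hE.1])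
  have h := tendsto_Su (Real.sqrt_pos.2 hpos)
  rw [Real.sq_sqrt hpos.le] at h
  exact h.const_sub (Uu R σ2 E)
end
end
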